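/- arXiv:2312.08941 — 2 statements merged into one kernel-verified Lean document; each statement's English description precedes it below -/
import Mathlib

section
/- Let 1 < p, p_i < ∞, p ≤ q, with ∑_{i=1}^m 1/p_i = 1/p; let φ, φ_i ∈ 𝒢^dec satisfy ∏ φ_i^{1/p_i} = φ^{1/p}, lim_{r→0} φ(x,r) = ∞, lim_{r→∞} φ(x,r) = 0, and ∫_r^∞ φ(x,t)/t dt ≤ C φ(x,r); let ψ ∈ 𝒢^inc satisfy C⁻¹ ≤ ψ(x,r)/ψ(y,r) ≤ C for |x−y| ≤ r and ψ(x,r)φ(x,r)^{1/p} ≤ C₀ φ(x,r)^{1/q}; let K satisfy |K(x,y⃗)| ≤ A/(∑_{i=1}^m |x−y_i|)^{mn}. Then there is a constant C such that for all b_j ∈ 𝓛^{(1,ψ)}(ℝⁿ), all f_i ∈ L^{(p_i,φ_i)}(ℝⁿ), and all balls B = B(z,r): | (1/|B|)∫_B ( ∫_{((2B)^∁)^m} K(x,y⃗)(b_j(x) − b_j(y_j)) ∏_{i=1}^m f_i(y_i) dy⃗ ) dx | ≤ C φ(z,r)^{1/q} ‖b_j‖_{𝓛^{(1,ψ)}}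 ∏_{i=1}^m ‖f_i‖_{L^{(p_i,φ_i)}}. -/
open MeasureTheory Metric ENNReal

/-- Average of `f` over the ball `B(x,r)`. -/
noncomputable def ballAvg (n : ℕ) (f : EuclideanSpace ℝ (Fin n) → ℝ)
    (x : EuclideanSpace ℝ (Fin n)) (r : ℝ) : ℝ :=
  ⨍ y in ball x r, f y

/-- The generalized Morrey norm of a real function. -/
noncomputable def morreyNorm (n : ℕ) (p : ℝ)
    (φ : EuclideanSpace ℝ (Fin n) → ℝ → ℝ) (f : EuclideanSpace ℝ (Fin n) → ℝ) : ℝ≥0∞ :=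
  ⨆ (x : EuclideanSpace ℝ (Fin n)) (r : ℝ) (_ : 0 < r),
    ((∫⁻ y in ball x r, ENNReal.ofReal (|f y| ^ p)) /
      (ENNReal.ofReal (φ x r) * volume (ball x r))) ^ (1 / p)

/-- The generalized Campanato norm `‖b‖_{𝓛^{(1,ψ)}}`. -/
noncomputable def campanatoNorm (n : ℕ)
    (ψ : EuclideanSpace ℝ (Fin n) → ℝ → ℝ) (b : EuclideanSpace ℝ (Fin n) → ℝ) : ℝ≥0∞ :=
  ⨆ (x : EuclideanSpace ℝ (Fin n)) (r : ℝ) (_ : 0 < r),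
    (∫⁻ y in ball x r, ENNReal.ofReal |b y - ballAvg n b x r|) /
      (ENNReal.ofReal (ψ x r) * volume (ball x r))

/-- `φ ∈ 𝒢^dec`. -/
def Gdec (n : ℕ) (φ : EuclideanSpace ℝ (Fin n) → ℝ → ℝ) : Prop :=
  ∃ C > (0 : ℝ), ∀ x (r s : ℝ), 0 < r → r < s →
    φ x s ≤ C * φ x r ∧ φ x r * r ^ (n : ℝ) ≤ C * (φ x s * s ^ (n : ℝ))

/-- `ψ ∈ 𝒢^inc`. -/
def Ginc (n : ℕ) (ψ : EuclideanSpace ℝ (Fin n) → ℝ → ℝ) : Prop :=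
  ∃ C > (0 : ℝ), ∀ x (r s : ℝ), 0 < r → r < s →
    ψ x r ≤ C * ψ x s ∧ ψ x s / s ≤ C * (ψ x r / r)

lemma lintegral_fin_prod_aux {m : ℕ} {E : Type} [MeasurableSpace E] (μ : Fin m → Measure E)
    [∀ i, SigmaFinite (μ i)] (g : Fin m → E → ℝ≥0∞) (hg : ∀ i, AEMeasurable (g i) (μ i)) :
    ∫⁻ y, ∏ i, g i (y i) ∂(Measure.pi μ) = ∏ i, ∫⁻ x, g i x ∂(μ i) := by
  induction m with
  | zero => simp
  | succ m ih =>
    have h := (measurePreserving_piFinSuccAbove μ 0).symm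
    rw [← h.lintegral_comp_emb (MeasurableEquiv.measurableEmbedding _)]
    simp only [MeasurableEquiv.piFinSuccAbove_symm_apply, Fin.insertNthEquiv,
      Fin.prod_univ_succ, Fin.insertNth_zero, Equiv.coe_fn_mk, Fin.cons_succ,
      Fin.zero_succAbove, cast_eq, Fin.cons_zero]
    rw [lintegral_prod_mul (g := fun y : Fin m → E => ∏ i : Fin m, g i.succ (y i)) (hg 0),
      ih _ _ (fun i => hg i.succ)]
    exact Finset.aemeasurable_fun_prod _ fun i _ =>
      (hg i.succ).comp_quasiMeasurePreserving
        (Measure.quasiMeasurePreserving_eval (fun j : Fin m => μ j.succ) i)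

lemma decay_aux (a : ℕ → ℝ) (ha : ∀ k, 0 < a k) (c : ℝ) (hc : 0 < c)
    (h : ∀ j N, ∑ k ∈ Finset.range N, a (j + k + 1) ≤ c * a j) (k : ℕ) :
    a k ≤ (1 + c) * (c / (1 + c)) ^ k * a 0 := by
  have hs : Summable a := by
    rw [← summable_nat_add_iff 1]
    refine summable_of_sum_range_le (c := c * a 0) (fun n => (ha _).le) fun N => ?_
    simpa using h 0 N
  have hsj : ∀ j, Summable fun k => a (k + j) := fun j => (summable_nat_add_iff j).2 hs
  set S : ℕ → ℝ := fun j => ∑' k, a (k + j) with hS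
  have h1 : ∀ j, S j = a j + S (j + 1) := fun j => by
    have := (hsj j).tsum_eq_zero_add
    simp only [hS]
    rw [this]; simp only [zero_add, add_assoc, add_comm 1 j]
  have h2 : ∀ j, S (j + 1) ≤ c * a j := fun j => by
    refine Real.tsum_le_of_sum_range_le (fun n => (ha _).le) fun N => ?_
    refine le_trans (le_of_eq ?_) (h j N)
    refine Finset.sum_congr rfl fun k _ => ?_
    congr 1; ring
  have h3 : ∀ j, S (j + 1) ≤ (c / (1 + c)) * S j := fun j => by
    rw [div_mul_eq_mul_div, le_div_iff₀ (by positivity)]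
    nlinarith [h1 j, h2 j]
  have h4 : ∀ j, S j ≤ (c / (1 + c)) ^ j * S 0 := fun j => by
    induction j with
    | zero => simp
    | succ j ih =>
      calc S (j + 1) ≤ (c / (1 + c)) * S j := h3 j
        _ ≤ (c / (1 + c)) * ((c / (1 + c)) ^ j * S 0) := by gcongr
        _ = _ := by ring
  have hpos : ∀ j, 0 ≤ S j := fun j => tsum_nonneg fun _ => (ha _).le
  have h5 : S 0 ≤ (1 + c) * a 0 := by nlinarith [h1 0, h2 0]
  calc a k ≤ S k := by rw [h1 k]; linarith [hpos (k + 1)]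
    _ ≤ (c / (1 + c)) ^ k * S 0 := h4 k
    _ ≤ (c / (1 + c)) ^ k * ((1 + c) * a 0) := by gcongr
    _ = _ := by ring

lemma phi_decay (n : ℕ) (φ : EuclideanSpace ℝ (Fin n) → ℝ → ℝ)
    (hφpos : ∀ x r, 0 < r → 0 < φ x r) (hφdec : Gdec n φ)
    (C₁ : ℝ) (hC₁ : 0 < C₁)
    (hint : ∀ x (r : ℝ), 0 < r →
      ∫⁻ t in Set.Ioi r, ENNReal.ofReal (φ x t / t) ≤ ENNReal.ofReal (C₁ * φ x r)) :
    ∃ C θ : ℝ, 0 < C ∧ 0 < θ ∧ θ < 1 ∧ ∀ x r (k : ℕ), 0 < r →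
      φ x (2 ^ k * r) ≤ C * θ ^ k * φ x r := by
  obtain ⟨D, hD, hdec⟩ := hφdec
  refine ⟨1 + 2 * D * C₁, 2 * D * C₁ / (1 + 2 * D * C₁), by positivity, by positivity, ?_, ?_⟩
  · rw [div_lt_one (by positivity)]; linarith
  intro x r k hr
  have key := decay_aux (fun k => φ x (2 ^ k * r)) (fun k => hφpos _ _ (by positivity))
    (2 * D * C₁) (by positivity) ?_ k
  · simpa using key
  intro j N
  have hpiece : ∀ i : ℕ, ENNReal.ofReal (φ x (2 ^ (j + i + 1) * r) / (2 * D)) ≤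
      ∫⁻ t in Set.Ioo (2 ^ (j + i) * r) (2 ^ (j + i + 1) * r), ENNReal.ofReal (φ x t / t) := by
    intro i
    set u : ℝ := 2 ^ (j + i) * r with hu
    have hupos : 0 < u := by positivity
    have hu2 : (2 : ℝ) ^ (j + i + 1) * r = 2 * u := by rw [hu]; ring
    rw [hu2]
    have : ∀ t ∈ Set.Ioo u (2 * u), ENNReal.ofReal (φ x (2 * u) / D / (2 * u)) ≤
        ENNReal.ofReal (φ x t / t) := by
      intro t ht
      have ht0 : 0 < t := hupos.trans ht.1
      apply ENNReal.ofReal_le_ofReal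
      have := (hdec x t (2 * u) ht0 ht.2).1
      have hb : φ x (2 * u) / D ≤ φ x t := by rw [div_le_iff₀ hD]; linarith
      have := hφpos x t ht0
      gcongr
      exact ht.2.le
    refine le_trans ?_ (setLIntegral_mono' measurableSet_Ioo this)
    rw [setLIntegral_const, Real.volume_Ioo, ← ENNReal.ofReal_mul]
    · apply ENNReal.ofReal_le_ofReal
      apply le_of_eq; field_simp; ring
    · have := hφpos x (2 * u) (by positivity); positivity
  have hle : ∑ i ∈ Finset.range N, ENNReal.ofReal (φ x (2 ^ (j + i + 1) * r) / (2 * D)) ≤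
      ENNReal.ofReal (C₁ * φ x (2 ^ j * r)) := by
    refine (Finset.sum_le_sum fun i _ => hpiece i).trans ?_
    refine le_trans ?_ (hint x (2 ^ j * r) (by positivity))
    rw [← lintegral_biUnion_finset]
    · apply lintegral_mono_set
      intro t ht
      simp only [Set.mem_iUnion, Set.mem_Ioo] at ht
      obtain ⟨i, _, hi, _⟩ := ht
      refine lt_of_le_of_lt ?_ hi
      gcongr
      · norm_num
      · omega
    · intro i _ i' _ hii
      rcases lt_or_gt_of_ne hii with h | h
      · refine Set.disjoint_left.2 fun t ht ht' => ?_
        have : (2 : ℝ) ^ (j + i + 1) * r ≤ 2 ^ (j + i') * r := by gcongr ?_ * r; exact pow_le_pow_right₀ (by norm_num) (by omega)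
        linarith [ht.2, ht'.1]
      · refine Set.disjoint_left.2 fun t ht ht' => ?_
        have : (2 : ℝ) ^ (j + i' + 1) * r ≤ 2 ^ (j + i) * r := by gcongr ?_ * r; exact pow_le_pow_right₀ (by norm_num) (by omega)
        linarith [ht.1, ht'.2]
    · intro i _; exact measurableSet_Ioo
  have hφj : 0 < φ x (2 ^ j * r) := hφpos _ _ (by positivity)
  rw [← ENNReal.ofReal_sum_of_nonneg, ENNReal.ofReal_le_ofReal_iff (by positivity),
    ← Finset.sum_div, div_le_iff₀ (by positivity)] at hle
  · linarith
  · intro i _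
    have := hφpos x (2 ^ (j + i + 1) * r) (by positivity); positivity

lemma vol_ball_aux {n : ℕ} (x : EuclideanSpace ℝ (Fin n)) {r : ℝ} (hr : 0 < r) :
    volume (ball x r) = ENNReal.ofReal (r ^ n) *
      volume (ball (0 : EuclideanSpace ℝ (Fin n)) 1) := by
  have := Measure.addHaar_ball_of_pos (volume : Measure (EuclideanSpace ℝ (Fin n))) x hr
  simpa using this

lemma vol_closedBall_aux {n : ℕ} (x : EuclideanSpace ℝ (Fin n)) {r : ℝ} (hr : 0 < r) :
    volume (closedBall x r) = volume (ball x r) := by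
  rw [vol_ball_aux x hr]
  have := Measure.addHaar_closedBall (volume : Measure (EuclideanSpace ℝ (Fin n))) x hr.le
  simpa using this

lemma vol_ball_scale {n : ℕ} (x y : EuclideanSpace ℝ (Fin n)) {r c : ℝ} (hr : 0 < r)
    (hc : 0 < c) :
    volume (ball x (c * r)) = ENNReal.ofReal (c ^ n) * volume (ball y r) := by
  rw [vol_ball_aux x (by positivity), vol_ball_aux y hr, ← mul_assoc, ← ENNReal.ofReal_mul
    (by positivity), mul_pow]

lemma vol_ball_pos {n : ℕ} (x : EuclideanSpace ℝ (Fin n)) {r : ℝ} (hr : 0 < r) :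
    volume (ball x r) ≠ 0 := (measure_ball_pos _ _ hr).ne'

lemma vol_ball_ne_top {n : ℕ} (x : EuclideanSpace ℝ (Fin n)) {r : ℝ} :
    volume (ball x r) ≠ ⊤ := measure_ball_lt_top.ne

lemma intOn_ball {n : ℕ} {b : EuclideanSpace ℝ (Fin n) → ℝ} (hb : LocallyIntegrable b volume)
    (x : EuclideanSpace ℝ (Fin n)) (r : ℝ) : IntegrableOn b (ball x r) volume :=
  (hb.integrableOn_isCompact (isCompact_closedBall x r)).mono_set ball_subset_closedBall

lemma avg_le_aux {n : ℕ} {b : EuclideanSpace ℝ (Fin n) → ℝ} (hb : LocallyIntegrable b volume)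
    (x : EuclideanSpace ℝ (Fin n)) {r : ℝ} (hr : 0 < r) (c : ℝ) :
    ENNReal.ofReal |ballAvg n b x r - c| * volume (ball x r) ≤
      ∫⁻ y in ball x r, ENNReal.ofReal |b y - c| := by
  have hv0 := vol_ball_pos x hr
  have hvt := vol_ball_ne_top x (r := r)
  have hvr : 0 < volume.real (ball x r) := ENNReal.toReal_pos hv0 hvt
  have h1 : (ballAvg n b x r - c) * volume.real (ball x r) = ∫ y in ball x r, (b y - c) := by
    rw [integral_sub (intOn_ball hb x r) (integrableOn_const hvt), ballAvg, setAverage_eq]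
    simp only [smul_eq_mul, integral_const, measureReal_restrict_apply_univ]
    field_simp
  have h2 := enorm_integral_le_lintegral_enorm (μ := volume.restrict (ball x r))
    (fun y => b y - c)
  rw [← h1] at h2
  simp only [Real.enorm_eq_ofReal_abs, abs_mul, abs_of_pos hvr] at h2
  rwa [ENNReal.ofReal_mul (abs_nonneg _), measureReal_def, ENNReal.ofReal_toReal hvt] at h2

lemma avg_diff_aux {n : ℕ} {b : EuclideanSpace ℝ (Fin n) → ℝ} (hb : LocallyIntegrable b volume)
    (x : EuclideanSpace ℝ (Fin n)) {r M : ℝ} (hr : 0 < r) (hM : 0 < M)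
    (h : ∫⁻ y in ball x (2 * r), ENNReal.ofReal |b y - ballAvg n b x (2 * r)| ≤
      ENNReal.ofReal M * volume (ball x (2 * r))) :
    |ballAvg n b x r - ballAvg n b x (2 * r)| ≤ 2 ^ n * M := by
  have h1 := avg_le_aux hb x hr (ballAvg n b x (2 * r))
  have h2 : ∫⁻ y in ball x r, ENNReal.ofReal |b y - ballAvg n b x (2 * r)| ≤
      ∫⁻ y in ball x (2 * r), ENNReal.ofReal |b y - ballAvg n b x (2 * r)| :=
    lintegral_mono_set (ball_subset_ball (by linarith))
  have h3 := h1.trans (h2.trans h)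
  rw [vol_ball_scale x x hr (by norm_num : (0 : ℝ) < 2), ← mul_assoc,
    ENNReal.mul_le_mul_iff_left (vol_ball_pos x hr) (vol_ball_ne_top x),
    ← ENNReal.ofReal_mul hM.le, ENNReal.ofReal_le_ofReal_iff (by positivity)] at h3
  linarith

lemma osc_double_aux {n : ℕ} {b : EuclideanSpace ℝ (Fin n) → ℝ}
    (hb : LocallyIntegrable b volume)
    (x : EuclideanSpace ℝ (Fin n)) {r M : ℝ} (hr : 0 < r) (hM : 0 < M)
    (h : ∫⁻ y in ball x (2 * r), ENNReal.ofReal |b y - ballAvg n b x (2 * r)| ≤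
      ENNReal.ofReal M * volume (ball x (2 * r))) :
    ∫⁻ y in ball x (2 * r), ENNReal.ofReal |b y - ballAvg n b x r| ≤
      ENNReal.ofReal (M * (1 + 2 ^ n)) * volume (ball x (2 * r)) := by
  have h1 := avg_diff_aux hb x hr hM h
  calc ∫⁻ y in ball x (2 * r), ENNReal.ofReal |b y - ballAvg n b x r|
      ≤ ∫⁻ y in ball x (2 * r), (ENNReal.ofReal |b y - ballAvg n b x (2 * r)| +
          ENNReal.ofReal (2 ^ n * M)) := by
        refine lintegral_mono fun y => ?_
        rw [← ENNReal.ofReal_add (abs_nonneg _) (by positivity)]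
        apply ENNReal.ofReal_le_ofReal
        have := abs_sub_le (b y) (ballAvg n b x (2 * r)) (ballAvg n b x r)
        rw [abs_sub_comm (ballAvg n b x (2 * r))] at this
        linarith
    _ = (∫⁻ y in ball x (2 * r), ENNReal.ofReal |b y - ballAvg n b x (2 * r)|) +
          ENNReal.ofReal (2 ^ n * M) * volume (ball x (2 * r)) := by
        rw [lintegral_add_right _ measurable_const, setLIntegral_const]
    _ ≤ ENNReal.ofReal M * volume (ball x (2 * r)) +
          ENNReal.ofReal (2 ^ n * M) * volume (ball x (2 * r)) := by gcongr
    _ = _ := by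
        rw [← add_mul, ← ENNReal.ofReal_add hM.le (by positivity)]
        congr 2; ring

lemma jn_covering {n : ℕ} {g : EuclideanSpace ℝ (Fin n) → ℝ} (hg : LocallyIntegrable g volume)
    (hg0 : ∀ y, 0 ≤ g y) {ρ : ℝ} (hρ : 0 < ρ) (L : ℝ) (hL : 0 < L) :
    ∀ᵐ y ∂(volume : Measure (EuclideanSpace ℝ (Fin n))), L < g y →
      ∃ j : ℕ, ENNReal.ofReal L * volume (ball y (ρ / 5 ^ j)) <
        ∫⁻ u in closedBall y (ρ / 5 ^ j), ENNReal.ofReal (g u) := by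
  filter_upwards [IsUnifLocDoublingMeasure.ae_tendsto_average volume hg 1] with y hy hLy
  have hδ : Filter.Tendsto (fun j : ℕ => ρ / 5 ^ j) Filter.atTop
      (nhdsWithin 0 (Set.Ioi 0)) := by
    rw [tendsto_nhdsWithin_iff]
    refine ⟨?_, Filter.Eventually.of_forall fun j => by
      simp only [Set.mem_Ioi]; positivity⟩
    have := (tendsto_pow_atTop_nhds_zero_of_lt_one (r := (1 / 5 : ℝ)) (by norm_num)
      (by norm_num)).const_mul ρ
    simpa [div_eq_mul_inv] using this
  have h1 := hy (fun _ => y) _ hδ (Filter.Eventually.of_forall fun j => by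
    apply mem_closedBall_self; positivity)
  obtain ⟨j, hj⟩ := (h1.eventually (lt_mem_nhds hLy)).exists
  refine ⟨j, ?_⟩
  have hr : 0 < ρ / 5 ^ j := by positivity
  rw [← vol_closedBall_aux y hr]
  set r := ρ / 5 ^ j
  have hvt : volume (closedBall y r) ≠ ⊤ := measure_closedBall_lt_top.ne
  have hv0 : volume (closedBall y r) ≠ 0 := by
    rw [vol_closedBall_aux y hr]; exact vol_ball_pos y hr
  have hvr : 0 < volume.real (closedBall y r) := ENNReal.toReal_pos hv0 hvt
  rw [← ofReal_integral_eq_lintegral_ofReal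
    (hg.integrableOn_isCompact (isCompact_closedBall y r))
    (Filter.Eventually.of_forall hg0)]
  rw [setAverage_eq, smul_eq_mul, inv_mul_eq_div, lt_div_iff₀ hvr] at hj
  rw [← ENNReal.ofReal_toReal hvt, ← ENNReal.ofReal_mul hL.le]
  exact (ENNReal.ofReal_lt_ofReal_iff_of_nonneg (by positivity)).2 hj

lemma jn_step {n : ℕ} {b : EuclideanSpace ℝ (Fin n) → ℝ} (hb : LocallyIntegrable b volume)
    (z : EuclideanSpace ℝ (Fin n)) {R M : ℝ} (hM : 0 < M)
    (hosc : ∀ x ρ, 0 < ρ → dist x z + ρ ≤ 2 * R →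
      ∫⁻ y in ball x ρ, ENNReal.ofReal |b y - ballAvg n b x ρ| ≤
        ENNReal.ofReal M * volume (ball x ρ))
    {l : ℝ} (hl : 0 ≤ l) (θ : ℝ≥0∞)
    (h : ∀ x ρ, 0 < ρ → dist x z + 2 * ρ ≤ 2 * R →
      volume {y ∈ ball x ρ | l < |b y - ballAvg n b x ρ|} ≤ θ * volume (ball x ρ))
    (x : EuclideanSpace ℝ (Fin n)) {ρ : ℝ} (hρ : 0 < ρ) (hx : dist x z + 2 * ρ ≤ 2 * R) :
    volume {y ∈ ball x ρ | l + (2 * 10 ^ n * (1 + 2 ^ n)) * M < |b y - ballAvg n b x ρ|} ≤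
      θ / 2 * volume (ball x ρ) := by
  set κ : ℝ := 2 * 10 ^ n * (1 + 2 ^ n) with hκ
  have hκ0 : 0 < κ := by positivity
  set c := ballAvg n b x ρ with hc
  have hI2 := osc_double_aux hb x hρ hM (hosc x (2 * ρ) (by linarith) hx)
  rw [← hc] at hI2
  have hgint : LocallyIntegrable (fun y => |b y - c|) volume := by
    have : LocallyIntegrable (fun y => b y - c) volume :=
      hb.sub (locallyIntegrable_const c)
    intro w
    obtain ⟨V, hV, hVi⟩ := this w
    exact ⟨V, hV, hVi.norm⟩
  have hcover := jn_covering hgint (fun y => abs_nonneg _) hρ (κ * M) (by positivity)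
  set T := {y ∈ ball x ρ | l + κ * M < |b y - c|} with hT
  set T' := {y ∈ T | ∃ j : ℕ, ENNReal.ofReal (κ * M) * volume (ball y (ρ / 5 ^ j)) <
        ∫⁻ u in closedBall y (ρ / 5 ^ j), ENNReal.ofReal |b u - c|} with hT'
  have hTT' : volume T ≤ volume T' := by
    apply measure_mono_ae
    filter_upwards [hcover] with y hy hyT
    exact ⟨hyT, hy (by have := hyT.2; linarith)⟩
  -- choose radii
  have hrad : ∀ y ∈ T', ∃ t : ℝ, 0 < t ∧ 5 * t ≤ ρ / 5 ∧
      ENNReal.ofReal (κ * M) * volume (ball y t) <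
        ∫⁻ u in closedBall y t, ENNReal.ofReal |b u - c| ∧
      ∫⁻ u in closedBall y (5 * t), ENNReal.ofReal |b u - c| ≤
        ENNReal.ofReal (κ * M) * volume (ball y (5 * t)) := by
    intro y hy
    classical
    obtain ⟨⟨hyb, _⟩, hex⟩ := hy
    have hsmall : ∀ t, ρ / 5 ≤ t → t ≤ ρ →
      ∫⁻ u in closedBall y t, ENNReal.ofReal |b u - c| ≤
        ENNReal.ofReal (κ * M) * volume (ball y t) := by
      intro t ht ht'
      have ht0 : 0 < t := by linarith
      calc ∫⁻ u in closedBall y t, ENNReal.ofReal |b u - c|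
          ≤ ∫⁻ u in ball x (2 * ρ), ENNReal.ofReal |b u - c| := by
            apply lintegral_mono_set
            apply closedBall_subset_ball'
            have := mem_ball.1 hyb
            linarith
        _ ≤ ENNReal.ofReal (M * (1 + 2 ^ n)) * volume (ball x (2 * ρ)) := hI2
        _ ≤ ENNReal.ofReal (M * (1 + 2 ^ n)) * volume (ball x (10 * t)) := by
            refine mul_le_mul_right (measure_mono (ball_subset_ball (by linarith))) _
        _ = ENNReal.ofReal (M * (1 + 2 ^ n) * 10 ^ n) * volume (ball y t) := by
            rw [vol_ball_scale x y ht0 (by norm_num : (0 : ℝ) < 10), ← mul_assoc,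
              ← ENNReal.ofReal_mul (by positivity)]
        _ ≤ _ := by
            refine mul_le_mul_left (ENNReal.ofReal_le_ofReal ?_) _
            rw [hκ]
            have : 0 ≤ M * (1 + 2 ^ n) * 10 ^ n := by positivity
            nlinarith
    have hfind := Nat.find_spec hex
    have hmin := fun k => Nat.find_min hex (m := k)
    set j := Nat.find hex
    have hj0 : j ≠ 0 := by
      intro h0
      rw [h0] at hfind
      exact absurd hfind (not_lt.2 (hsmall _ (by simp; linarith) (by simp)))
    have hj1 : j ≠ 1 := by
      intro h0
      rw [h0] at hfind
      exact absurd hfind (not_lt.2 (hsmall _ (by simp) (by simp; linarith)))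
    obtain ⟨k, hk⟩ : ∃ k, j = k + 2 := ⟨j - 2, by omega⟩
    have h5 : 5 * (ρ / 5 ^ j) = ρ / 5 ^ (k + 1) := by
      rw [hk, pow_succ 5 (k + 1)]; field_simp
    refine ⟨ρ / 5 ^ j, by positivity, ?_, hfind, ?_⟩
    · rw [h5]
      apply div_le_div_of_nonneg_left hρ.le (by norm_num)
      exact le_self_pow₀ (by norm_num) (by omega)
    · rw [h5]
      exact not_lt.1 (hmin (k + 1) (by omega))
  choose! t ht0 ht5 htl htu using hrad
  obtain ⟨u, huT, hdisj, hcov⟩ :=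
    Vitali.exists_disjoint_subfamily_covering_enlargement_closedBall T' (fun y => y) t ρ
      (fun y hy => by have := ht5 y hy; have := ht0 y hy; linarith) 4 (by norm_num)
  have hucount : u.Countable := by
    refine hdisj.countable_of_nonempty_interior fun y hy => ?_
    exact ⟨y, ball_subset_interior_closedBall (mem_ball_self (ht0 y (huT hy)))⟩
  have hcover : T' ⊆ ⋃ y ∈ u, {w ∈ ball y (5 * t y) | l < |b w - ballAvg n b y (5 * t y)|} := by
    intro w hw
    obtain ⟨y, hyu, hsub⟩ := hcov w hw
    have hyT := huT hyu
    have hty := ht0 y hyT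
    have hwy := hsub (mem_closedBall_self (ht0 w hw).le)
    simp only [Set.mem_iUnion]
    refine ⟨y, hyu, ?_, ?_⟩
    · rw [mem_ball]; rw [mem_closedBall] at hwy; linarith
    · have h1 := avg_le_aux hb y (by linarith : 0 < 5 * t y) c
      have h2 : ∫⁻ v in ball y (5 * t y), ENNReal.ofReal |b v - c| ≤
        ∫⁻ v in closedBall y (5 * t y), ENNReal.ofReal |b v - c| :=
        lintegral_mono_set ball_subset_closedBall
      have h3 := h1.trans (h2.trans (htu y hyT))
      rw [ENNReal.mul_le_mul_iff_left (vol_ball_pos y (by linarith)) (vol_ball_ne_top y),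
        ENNReal.ofReal_le_ofReal_iff (by positivity)] at h3
      have h4 := hw.1.2
      have := abs_sub_le (b w) (ballAvg n b y (5 * t y)) c
      linarith
  have hterm : ∀ y ∈ u, volume {w ∈ ball y (5 * t y) | l < |b w - ballAvg n b y (5 * t y)|} ≤
      θ * ENNReal.ofReal (5 ^ n / (κ * M)) *
        ∫⁻ v in closedBall y (t y), ENNReal.ofReal |b v - c| := by
    intro y hy
    have hyT := huT hy
    have hty := ht0 y hyT
    have h5y := ht5 y hyT
    have hyb := mem_ball.1 hyT.1.1
    have htri := dist_triangle y x z
    have h1 := h y (5 * t y) (by linarith) (by linarith)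
    refine h1.trans ?_
    rw [vol_ball_scale y y hty (by norm_num : (0 : ℝ) < 5), mul_assoc]
    refine mul_le_mul_right ?_ θ
    calc ENNReal.ofReal (5 ^ n) * volume (ball y (t y))
        = ENNReal.ofReal (5 ^ n / (κ * M)) *
          (ENNReal.ofReal (κ * M) * volume (ball y (t y))) := by
          rw [← mul_assoc, ← ENNReal.ofReal_mul (by positivity)]
          congr 2; field_simp
      _ ≤ _ := mul_le_mul_right (htl y hyT).le _
  calc volume T ≤ volume T' := hTT'
    _ ≤ volume (⋃ y ∈ u, {w ∈ ball y (5 * t y) | l < |b w - ballAvg n b y (5 * t y)|}) :=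
        measure_mono hcover
    _ ≤ ∑' y : u, volume {w ∈ ball (y : EuclideanSpace ℝ (Fin n)) (5 * t y) |
          l < |b w - ballAvg n b y (5 * t y)|} := measure_biUnion_le _ hucount _
    _ ≤ ∑' y : u, θ * ENNReal.ofReal (5 ^ n / (κ * M)) *
        ∫⁻ v in closedBall (y : EuclideanSpace ℝ (Fin n)) (t y), ENNReal.ofReal |b v - c| :=
        ENNReal.tsum_le_tsum fun y => hterm y y.2
    _ = θ * ENNReal.ofReal (5 ^ n / (κ * M)) *
        ∫⁻ v in ⋃ y ∈ u, closedBall y (t y), ENNReal.ofReal |b v - c| := by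
        rw [ENNReal.tsum_mul_left, lintegral_biUnion hucount
          (fun y _ => isClosed_closedBall.measurableSet) hdisj]
    _ ≤ θ * ENNReal.ofReal (5 ^ n / (κ * M)) *
        ∫⁻ v in ball x (2 * ρ), ENNReal.ofReal |b v - c| := by
        refine mul_le_mul_right (lintegral_mono_set ?_) _
        refine Set.iUnion₂_subset fun y hy => closedBall_subset_ball' ?_
        have := mem_ball.1 (huT hy).1.1
        have := ht5 y (huT hy)
        have := ht0 y (huT hy)
        linarith
    _ ≤ θ * ENNReal.ofReal (5 ^ n / (κ * M)) *
        (ENNReal.ofReal (M * (1 + 2 ^ n)) * volume (ball x (2 * ρ))) := by gcongr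
    _ = θ * (ENNReal.ofReal (5 ^ n / (κ * M) * (M * (1 + 2 ^ n)) * 2 ^ n)) *
          volume (ball x ρ) := by
        have e1 : ENNReal.ofReal (5 ^ n / (κ * M) * (M * (1 + 2 ^ n)) * 2 ^ n) =
            ENNReal.ofReal (5 ^ n / (κ * M)) * ENNReal.ofReal (M * (1 + 2 ^ n)) *
              ENNReal.ofReal (2 ^ n) := by
          rw [ENNReal.ofReal_mul (by positivity), ENNReal.ofReal_mul (by positivity)]
        rw [vol_ball_scale x x hρ (by norm_num : (0 : ℝ) < 2), e1]
        ring
    _ = θ / 2 * volume (ball x ρ) := by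
        have : 5 ^ n / (κ * M) * (M * (1 + 2 ^ n)) * 2 ^ n = (2 : ℝ)⁻¹ := by
          rw [hκ, show (10 : ℝ) = 5 * 2 by norm_num, mul_pow]; field_simp
        rw [this, ENNReal.ofReal_inv_of_pos (by norm_num), div_eq_mul_inv]
        simp

lemma jn_iter {n : ℕ} {b : EuclideanSpace ℝ (Fin n) → ℝ} (hb : LocallyIntegrable b volume)
    (z : EuclideanSpace ℝ (Fin n)) {R M : ℝ} (hM : 0 < M)
    (hosc : ∀ x ρ, 0 < ρ → dist x z + ρ ≤ 2 * R →
      ∫⁻ y in ball x ρ, ENNReal.ofReal |b y - ballAvg n b x ρ| ≤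
        ENNReal.ofReal M * volume (ball x ρ)) (k : ℕ) :
    ∀ x ρ, 0 < ρ → dist x z + 2 * ρ ≤ 2 * R →
      volume {y ∈ ball x ρ | k * ((2 * 10 ^ n * (1 + 2 ^ n)) * M) < |b y - ballAvg n b x ρ|} ≤
       ENNReal.ofReal ((1 / 2) ^ k) * volume (ball x ρ) := by
  induction k with
  | zero =>
    intro x ρ _ _
    simp only [pow_zero, ENNReal.ofReal_one, one_mul]
    exact measure_mono fun y hy => hy.1
  | succ k ih =>
    intro x ρ hρ hx
    have := jn_step hb z hM hosc (by positivity) _ ih x hρ hx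
    rw [Nat.cast_succ, add_mul, one_mul]
    refine this.trans (le_of_eq ?_)
    rw [pow_succ, ENNReal.ofReal_mul (by positivity), div_eq_mul_inv]
    congr 2
    rw [one_div, ENNReal.ofReal_inv_of_pos (by norm_num)]
    simp

/-- `L^s` form of the John–Nirenberg inequality. -/
lemma jn_Ls (n : ℕ) (s : ℝ) (hs : 1 < s) : ∃ C : ℝ, 0 < C ∧
    ∀ b : EuclideanSpace ℝ (Fin n) → ℝ, LocallyIntegrable b volume →
    ∀ (z : EuclideanSpace ℝ (Fin n)) (R M : ℝ), 0 < R → 0 < M →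
    (∀ x ρ, 0 < ρ → dist x z + ρ ≤ 2 * R →
      ∫⁻ y in ball x ρ, ENNReal.ofReal |b y - ballAvg n b x ρ| ≤
        ENNReal.ofReal M * volume (ball x ρ)) →
    (∫⁻ y in ball z R, ENNReal.ofReal |b y - ballAvg n b z R| ^ s) ≤
      ENNReal.ofReal (C * M) ^ s * volume (ball z R) := by
  have hsum : Summable fun k : ℕ => ((k : ℝ) + 1) ^ s * (1 / 2 : ℝ) ^ k := by
    have h0 := summable_pow_mul_geometric_of_norm_lt_one (⌈s⌉₊) (r := (1 / 2 : ℝ))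
      (by rw [Real.norm_eq_abs, abs_of_pos] <;> norm_num)
    have h1 := ((summable_nat_add_iff 1).2 h0).mul_left 2
    refine Summable.of_nonneg_of_le (fun k => by positivity) (fun k => ?_) h1
    have : ((k : ℝ) + 1) ^ s ≤ ((k : ℝ) + 1) ^ (⌈s⌉₊) := by
      rw [← Real.rpow_natCast]
      exact Real.rpow_le_rpow_of_exponent_le (by linarith [Nat.cast_nonneg (α := ℝ) k])
        (Nat.le_ceil s)
    calc ((k : ℝ) + 1) ^ s * (1 / 2 : ℝ) ^ k ≤ ((k : ℝ) + 1) ^ (⌈s⌉₊) * (1 / 2 : ℝ) ^ k := by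
          gcongr
      _ = _ := by push_cast; ring
  set S : ℝ := ∑' k : ℕ, ((k : ℝ) + 1) ^ s * (1 / 2 : ℝ) ^ k with hS
  have hS0 : 0 ≤ S := tsum_nonneg fun k => by positivity
  set κ : ℝ := 2 * 10 ^ n * (1 + 2 ^ n) with hκ
  have hκ0 : 0 < κ := by positivity
  refine ⟨κ * (S + 1) ^ (1 / s), by positivity, fun b hb z R M hR hM hosc => ?_⟩
  have hit := fun k => jn_iter hb z hM hosc k z R hR (by simp)
  set c := ballAvg n b z R
  set L : ℝ := κ * M with hL
  have hL0 : 0 < L := by positivity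
  let G : ℕ → Set (EuclideanSpace ℝ (Fin n)) := fun k => {y ∈ ball z R | k * L < |b y - c|}
  have hptw : ∀ y ∈ ball z R, ENNReal.ofReal |b y - c| ^ s ≤
      ∑' k : ℕ, ENNReal.ofReal (((k : ℝ) + 1) * L) ^ s *
        (toMeasurable volume (G k)).indicator (fun _ => (1 : ℝ≥0∞)) y := by
    intro y hy
    rcases eq_or_lt_of_le (abs_nonneg (b y - c)) with h0 | h0
    · rw [← h0]; simp [show 0 < s by linarith]
    · set k := ⌈|b y - c| / L⌉₊ - 1 with hk
      have hc1 : 0 < ⌈|b y - c| / L⌉₊ := Nat.ceil_pos.2 (by positivity)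
      have hk1 : ⌈|b y - c| / L⌉₊ = k + 1 := by omega
      have hk2 : |b y - c| ≤ ((k : ℝ) + 1) * L := by
        have := Nat.le_ceil (|b y - c| / L)
        rw [hk1, div_le_iff₀ hL0] at this
        exact_mod_cast this
      have hk3 : (k : ℝ) * L < |b y - c| := by
        have : (k : ℝ) < |b y - c| / L := Nat.lt_ceil.1 (by omega)
        rwa [lt_div_iff₀ hL0] at this
      refine le_trans ?_ (ENNReal.le_tsum k)
      have hmem : y ∈ toMeasurable volume (G k) := subset_toMeasurable _ _ ⟨hy, hk3⟩
      rw [Set.indicator_of_mem hmem, mul_one]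
      gcongr
  calc (∫⁻ y in ball z R, ENNReal.ofReal |b y - c| ^ s)
      ≤ ∫⁻ y in ball z R, ∑' k : ℕ, ENNReal.ofReal (((k : ℝ) + 1) * L) ^ s *
        (toMeasurable volume (G k)).indicator (fun _ => (1 : ℝ≥0∞)) y :=
        setLIntegral_mono' measurableSet_ball hptw
    _ ≤ ∫⁻ y, ∑' k : ℕ, ENNReal.ofReal (((k : ℝ) + 1) * L) ^ s *
        (toMeasurable volume (G k)).indicator (fun _ => (1 : ℝ≥0∞)) y :=
        setLIntegral_le_lintegral _ _
    _ = ∑' k : ℕ, ENNReal.ofReal (((k : ℝ) + 1) * L) ^ s * volume (G k) := by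
        have hm : ∀ k, Measurable ((toMeasurable volume (G k)).indicator
            (fun _ => (1 : ℝ≥0∞))) := fun k =>
          measurable_const.indicator (measurableSet_toMeasurable _ _)
        rw [lintegral_tsum fun k => ((hm k).const_mul _).aemeasurable]
        congr 1; ext k
        rw [lintegral_const_mul _ (hm k), lintegral_indicator_const
          (measurableSet_toMeasurable _ _), one_mul, measure_toMeasurable]
    _ ≤ ∑' k : ℕ, ENNReal.ofReal (((k : ℝ) + 1) * L) ^ s *
          (ENNReal.ofReal ((1 / 2) ^ k) * volume (ball z R)) := by
        gcongr with k; exact hit k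
    _ = ∑' k : ℕ, ENNReal.ofReal L ^ s *
          ENNReal.ofReal (((k : ℝ) + 1) ^ s * (1 / 2 : ℝ) ^ k) * volume (ball z R) := by
        congr 1; ext k
        have hk0 : (0 : ℝ) ≤ (k : ℝ) + 1 := by positivity
        rw [ENNReal.ofReal_mul hk0, ENNReal.mul_rpow_of_nonneg _ _ (by linarith),
          ENNReal.ofReal_mul (p := ((k : ℝ) + 1) ^ s) (by positivity),
          ENNReal.ofReal_rpow_of_nonneg hk0 (by linarith : 0 ≤ s)]
        ring
    _ = ENNReal.ofReal L ^ s * ENNReal.ofReal S * volume (ball z R) := by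
        rw [ENNReal.tsum_mul_right, ENNReal.tsum_mul_left,
          ENNReal.ofReal_tsum_of_nonneg (fun k => by positivity) hsum]
    _ ≤ _ := by
        gcongr
        have : κ * (S + 1) ^ (1 / s) * M = L * (S + 1) ^ (1 / s) := by rw [hL]; ring
        rw [this, ENNReal.ofReal_mul hL0.le, ENNReal.mul_rpow_of_nonneg _ _ (by linarith)]
        gcongr
        rw [ENNReal.ofReal_rpow_of_nonneg (by positivity) (by linarith : 0 ≤ s),
          ← Real.rpow_mul (by positivity), one_div, inv_mul_cancel₀ (by linarith),
          Real.rpow_one]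
        apply ENNReal.ofReal_le_ofReal; linarith

lemma camp_osc {n : ℕ} {ψ : EuclideanSpace ℝ (Fin n) → ℝ → ℝ}
    (hψpos : ∀ x r, 0 < r → 0 < ψ x r) {b : EuclideanSpace ℝ (Fin n) → ℝ} {N : ℝ}
    (hN : 0 < N) (hbN : campanatoNorm n ψ b ≤ ENNReal.ofReal N)
    (x : EuclideanSpace ℝ (Fin n)) {ρ : ℝ} (hρ : 0 < ρ) :
    ∫⁻ y in ball x ρ, ENNReal.ofReal |b y - ballAvg n b x ρ| ≤
      ENNReal.ofReal (N * ψ x ρ) * volume (ball x ρ) := by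
  have h1 : (∫⁻ y in ball x ρ, ENNReal.ofReal |b y - ballAvg n b x ρ|) /
      (ENNReal.ofReal (ψ x ρ) * volume (ball x ρ)) ≤ ENNReal.ofReal N := by
    refine le_trans ?_ hbN
    unfold campanatoNorm
    exact le_iSup_of_le x (le_iSup_of_le ρ (le_iSup_of_le hρ le_rfl))
  have hψ := hψpos x ρ hρ
  rw [ENNReal.div_le_iff (mul_ne_zero (by simpa using hψ) (vol_ball_pos x hρ))
    (ENNReal.mul_ne_top ENNReal.ofReal_ne_top (vol_ball_ne_top x))] at h1
  rwa [ENNReal.ofReal_mul hN.le, mul_assoc]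

lemma psi_mono {n : ℕ} {ψ : EuclideanSpace ℝ (Fin n) → ℝ → ℝ}
    (hψpos : ∀ x r, 0 < r → 0 < ψ x r) (hψinc : Ginc n ψ) :
    ∃ D : ℝ, 0 < D ∧ (∀ x r s, 0 < r → r ≤ s → ψ x r ≤ D * ψ x s) ∧
      (∀ x r, 0 < r → ψ x (2 * r) ≤ D * ψ x r) := by
  obtain ⟨C, hC, h⟩ := hψinc
  refine ⟨1 + 2 * C, by positivity, ?_, ?_⟩
  · intro x r s hr hrs
    have := hψpos x s (by linarith)
    rcases eq_or_lt_of_le hrs with rfl | hlt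
    · nlinarith
    · have := (h x r s hr hlt).1
      nlinarith
  · intro x r hr
    have h1 := (h x r (2 * r) hr (by linarith)).2
    have h0 := hψpos x r hr
    rw [div_le_iff₀ (by positivity)] at h1
    have : C * (ψ x r / r) * (2 * r) = 2 * C * ψ x r := by field_simp
    nlinarith

lemma camp_jn {n : ℕ} {ψ : EuclideanSpace ℝ (Fin n) → ℝ → ℝ}
    (hψpos : ∀ x r, 0 < r → 0 < ψ x r) (hψinc : Ginc n ψ)
    (hψunif : ∃ C > (0 : ℝ), ∀ x y (r : ℝ), 0 < r → dist x y ≤ r → ψ x r ≤ C * ψ y r)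
    (s : ℝ) (hs : 1 < s) :
    ∃ C : ℝ, 0 < C ∧ ∀ b : EuclideanSpace ℝ (Fin n) → ℝ, LocallyIntegrable b volume →
      ∀ N : ℝ, 0 < N → campanatoNorm n ψ b ≤ ENNReal.ofReal N →
      ∀ (z : EuclideanSpace ℝ (Fin n)) (R : ℝ), 0 < R →
      (∫⁻ y in ball z R, ENNReal.ofReal |b y - ballAvg n b z R| ^ s) ≤
        ENNReal.ofReal (C * N * ψ z R) ^ s * volume (ball z R) := by
  obtain ⟨D, hD, hmono, hdbl⟩ := psi_mono hψpos hψinc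
  obtain ⟨U, hU, hunif⟩ := hψunif
  obtain ⟨C, hC, hjn⟩ := jn_Ls n s hs
  refine ⟨C * (D * U * D), by positivity, fun b hb N hN hbN z R hR => ?_⟩
  have hψ := hψpos z R hR
  have := hjn b hb z R (D * U * D * N * ψ z R) hR (by positivity) ?_
  · refine this.trans (le_of_eq ?_)
    congr 3; ring
  · intro x ρ hρ hx
    refine (camp_osc hψpos hN hbN x hρ).trans ?_
    refine mul_le_mul_left (ENNReal.ofReal_le_ofReal ?_) _
    have hd : 0 ≤ dist x z := dist_nonneg
    have h1 := hmono x ρ (2 * R) hρ (by linarith)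
    have h2 := hunif x z (2 * R) (by linarith) (by linarith)
    have h3 := hdbl z R hR
    calc N * ψ x ρ ≤ N * (D * (U * (D * ψ z R))) := by
          gcongr
          refine h1.trans ?_
          gcongr
          refine h2.trans ?_
          gcongr
      _ = _ := by ring

lemma camp_chain {n : ℕ} {ψ : EuclideanSpace ℝ (Fin n) → ℝ → ℝ}
    (hψpos : ∀ x r, 0 < r → 0 < ψ x r) {D : ℝ} (hD : 0 < D)
    (hmono : ∀ x r s, 0 < r → r ≤ s → ψ x r ≤ D * ψ x s)
    {b : EuclideanSpace ℝ (Fin n) → ℝ} (hb : LocallyIntegrable b volume)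
    {N : ℝ} (hN : 0 < N) (hbN : campanatoNorm n ψ b ≤ ENNReal.ofReal N)
    (z : EuclideanSpace ℝ (Fin n)) {r : ℝ} (hr : 0 < r) (k : ℕ) :
    |ballAvg n b z r - ballAvg n b z (2 ^ k * r)| ≤
      k * (2 ^ n * (N * (D * ψ z (2 ^ k * r)))) := by
  have key : ∀ i : ℕ, i ≤ k → |ballAvg n b z r - ballAvg n b z (2 ^ i * r)| ≤
      i * (2 ^ n * (N * (D * ψ z (2 ^ k * r)))) := by
    intro i
    induction i with
    | zero => intro _; simp
    | succ i ih =>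
      intro hi
      have h1 := ih (by omega)
      have hpos : 0 < ψ z (2 ^ k * r) := hψpos _ _ (by positivity)
      have h2 := avg_diff_aux hb z (r := 2 ^ i * r) (M := N * (D * ψ z (2 ^ k * r)))
        (by positivity) (by positivity) (by
          refine (camp_osc hψpos hN hbN z (by positivity)).trans ?_
          refine mul_le_mul_left (ENNReal.ofReal_le_ofReal ?_) _
          gcongr
          apply hmono z _ _ (by positivity)
          rw [← mul_assoc, ← pow_succ']
          gcongr
          · norm_num)
      rw [← mul_assoc, ← pow_succ'] at h2
      have := abs_sub_le (ballAvg n b z r) (ballAvg n b z (2 ^ i * r))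
        (ballAvg n b z (2 ^ (i + 1) * r))
      push_cast
      linarith
  exact key k le_rfl

lemma morrey_holder {n : ℕ} {p s : ℝ} (hps : s.HolderConjugate p)
    {φ : EuclideanSpace ℝ (Fin n) → ℝ → ℝ} (hφpos : ∀ x r, 0 < r → 0 < φ x r)
    {f : EuclideanSpace ℝ (Fin n) → ℝ} (hf : Measurable f)
    (z : EuclideanSpace ℝ (Fin n)) {R : ℝ} (hR : 0 < R)
    (g : EuclideanSpace ℝ (Fin n) → ℝ≥0∞) (hg : AEMeasurable g volume) (G : ℝ≥0∞)
    (hG : ∫⁻ y in ball z R, g y ^ s ≤ G ^ s * volume (ball z R)) :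
    ∫⁻ y in ball z R, g y * ENNReal.ofReal |f y| ≤
      G * (volume (ball z R) * ENNReal.ofReal (φ z R ^ (1 / p)) * morreyNorm n p φ f) := by
  have hp0 : 0 < p := hps.symm.pos
  have hs0 : 0 < s := hps.pos
  have hφ := hφpos z R hR
  set V := volume (ball z R) with hV
  have hV0 : V ≠ 0 := vol_ball_pos z hR
  have hVt : V ≠ ⊤ := vol_ball_ne_top z
  have h1 : ((∫⁻ y in ball z R, ENNReal.ofReal (|f y| ^ p)) /
      (ENNReal.ofReal (φ z R) * V)) ^ (1 / p) ≤ morreyNorm n p φ f := by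
    unfold morreyNorm
    exact le_iSup_of_le z (le_iSup_of_le R (le_iSup_of_le hR le_rfl))
  have hd0 : ENNReal.ofReal (φ z R) * V ≠ 0 := mul_ne_zero (by simpa using hφ) hV0
  have hdt : ENNReal.ofReal (φ z R) * V ≠ ⊤ := ENNReal.mul_ne_top ENNReal.ofReal_ne_top hVt
  have h2 : (∫⁻ y in ball z R, ENNReal.ofReal |f y| ^ p) ^ (1 / p) ≤
      morreyNorm n p φ f * (ENNReal.ofReal (φ z R ^ (1 / p)) * V ^ (1 / p)) := by
    rw [ENNReal.div_rpow_of_nonneg _ _ (by positivity), ENNReal.div_le_iff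
      (by simp only [ne_eq, ENNReal.rpow_eq_zero_iff, not_or]
          exact ⟨fun h => hd0 h.1, fun h => hdt h.1⟩)
      (ENNReal.rpow_ne_top_of_nonneg (by positivity) hdt),
      ENNReal.mul_rpow_of_nonneg _ _ (by positivity),
      ENNReal.ofReal_rpow_of_pos hφ] at h1
    refine le_trans (le_of_eq ?_) h1
    congr 2; ext y
    rw [ENNReal.ofReal_rpow_of_nonneg (abs_nonneg _) hp0.le]
  have h3 := ENNReal.lintegral_mul_le_Lp_mul_Lq (volume.restrict (ball z R)) hps
    (f := g) (g := fun y => ENNReal.ofReal |f y|) hg.restrict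
    (by fun_prop)
  simp only [Pi.mul_apply] at h3
  have h4 : (∫⁻ y in ball z R, g y ^ s) ^ (1 / s) ≤ G * V ^ (1 / s) := by
    calc (∫⁻ y in ball z R, g y ^ s) ^ (1 / s) ≤ (G ^ s * V) ^ (1 / s) := by gcongr
      _ = _ := by
        rw [ENNReal.mul_rpow_of_nonneg _ _ (by positivity), ← ENNReal.rpow_mul,
          mul_one_div_cancel hs0.ne', ENNReal.rpow_one]
  have h5 : V ^ (1 / s) * V ^ (1 / p) = V := by
    rw [← ENNReal.rpow_add _ _ hV0 hVt]
    have := hps.inv_add_inv_eq_one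
    simp only [one_div, this, ENNReal.rpow_one]
  calc _ ≤ _ := h3
    _ ≤ (G * V ^ (1 / s)) *
        (morreyNorm n p φ f * (ENNReal.ofReal (φ z R ^ (1 / p)) * V ^ (1 / p))) := by gcongr
    _ = G * ((V ^ (1 / s) * V ^ (1 / p)) * ENNReal.ofReal (φ z R ^ (1 / p)) *
          morreyNorm n p φ f) := by ring
    _ = _ := by rw [h5]

lemma pi_lintegral {n m : ℕ} (z : EuclideanSpace ℝ (Fin n)) (R : ℝ)
    (g : Fin m → EuclideanSpace ℝ (Fin n) → ℝ≥0∞) (hg : ∀ i, AEMeasurable (g i) volume) :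
    ∫⁻ y in Set.univ.pi (fun _ : Fin m => ball z R), ∏ i, g i (y i) =
      ∏ i, ∫⁻ y in ball z R, g i y := by
  rw [volume_pi, Measure.restrict_pi_pi]
  exact lintegral_fin_prod_aux _ g fun i => (hg i).restrict

lemma inner_bound {n m : ℕ}
    (K : EuclideanSpace ℝ (Fin n) → (Fin m → EuclideanSpace ℝ (Fin n)) → ℝ)
    (A : ℝ) (hA : 0 < A)
    (hKsize : ∀ x y, (∃ i, y i ≠ x) →
      |K x y| ≤ A / (∑ i, dist x (y i)) ^ (m * n))
    {b : EuclideanSpace ℝ (Fin n) → ℝ} (hb : AEMeasurable b volume)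
    (j : Fin m) (f : Fin m → EuclideanSpace ℝ (Fin n) → ℝ) (hf : ∀ i, Measurable (f i))
    (z : EuclideanSpace ℝ (Fin n)) {r : ℝ} (hr : 0 < r) (c : ℕ → ℝ)
    (x : EuclideanSpace ℝ (Fin n)) (hx : x ∈ ball z r) :
    ∫⁻ y in Set.univ.pi (fun _ : Fin m => ((ball z (2 * r))ᶜ : Set (EuclideanSpace ℝ (Fin n)))),
      ‖K x y * (b x - b (y j)) * ∏ i, f i (y i)‖ₑ ≤
    ∑' k : ℕ, ENNReal.ofReal (A / (2 ^ k * r) ^ (m * n)) *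
      ∏ i, ∫⁻ y in ball z (2 ^ (k + 2) * r),
        (if i = j then ENNReal.ofReal |b x - c k| + ENNReal.ofReal |b y - c k| else 1) *
          ENNReal.ofReal |f i y| := by
  let P : ℕ → Set (Fin m → EuclideanSpace ℝ (Fin n)) :=
    fun k => Set.univ.pi fun _ => ball z (2 ^ (k + 1) * r)
  have hPm : ∀ k, MeasurableSet (P k) := fun k => MeasurableSet.univ_pi fun _ => measurableSet_ball
  have hcov : Set.univ.pi
      (fun _ : Fin m => ((ball z (2 * r))ᶜ : Set (EuclideanSpace ℝ (Fin n)))) ⊆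
      ⋃ k, P (k + 1) \ P k := by
    intro y hy
    classical
    have hex : ∃ k, y ∈ P k := by
      obtain ⟨k, hk⟩ := pow_unbounded_of_one_lt ((∑ i, dist (y i) z) / r)
        (by norm_num : (1 : ℝ) < 2)
      refine ⟨k, fun i _ => ?_⟩
      rw [div_lt_iff₀ hr] at hk
      have h1 : dist (y i) z ≤ ∑ i, dist (y i) z :=
        Finset.single_le_sum (f := fun i => dist (y i) z) (fun _ _ => dist_nonneg)
          (Finset.mem_univ i)
      have h2 : (2 : ℝ) ^ k * r ≤ 2 ^ (k + 1) * r := by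
        gcongr
        · norm_num
        · omega
      rw [mem_ball]; linarith
    have hfind := Nat.find_spec hex
    have hmin := fun k => Nat.find_min hex (m := k)
    have h0 : Nat.find hex ≠ 0 := by
      intro h0
      rw [h0] at hfind
      have h1 := hfind j (Set.mem_univ j)
      have h2 := hy j (Set.mem_univ j)
      simp only [zero_add, pow_one] at h1
      exact h2 h1
    obtain ⟨k, hk⟩ := Nat.exists_eq_succ_of_ne_zero h0
    rw [Set.mem_iUnion]
    exact ⟨k, by rw [hk] at hfind; exact hfind, hmin k (by omega)⟩
  refine (lintegral_mono_set hcov).trans ((lintegral_iUnion_le _ _).trans ?_)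
  refine ENNReal.tsum_le_tsum fun k => ?_
  let g : Fin m → EuclideanSpace ℝ (Fin n) → ℝ≥0∞ := fun i y =>
    (if i = j then ENNReal.ofReal |b x - c k| + ENNReal.ofReal |b y - c k| else 1) *
          ENNReal.ofReal |f i y|
  have hgm : ∀ i, AEMeasurable (g i) volume := by
    intro i
    have := hf i
    by_cases hij : i = j
    · simp only [g, hij, if_true]
      rw [hij] at this
      fun_prop
    · simp only [g, hij, if_false]
      fun_prop
  have hptw : ∀ y ∈ P (k + 1) \ P k, ‖K x y * (b x - b (y j)) * ∏ i, f i (y i)‖ₑ ≤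
      ENNReal.ofReal (A / (2 ^ k * r) ^ (m * n)) * ∏ i, g i (y i) := by
    intro y hy
    have hy2 : ∃ i, y i ∉ ball z (2 ^ (k + 1) * r) := by
      by_contra! hcon
      exact hy.2 fun i _ => hcon i
    obtain ⟨i₀, hi₀⟩ := hy2
    rw [mem_ball, not_lt] at hi₀
    rw [mem_ball] at hx
    have h2k : (1 : ℝ) ≤ 2 ^ k := one_le_pow₀ (by norm_num)
    have hdist : 2 ^ k * r ≤ dist x (y i₀) := by
      have := dist_triangle (y i₀) x z
      rw [dist_comm (y i₀) x] at this
      rw [pow_succ] at hi₀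
      nlinarith
    have h2kr : 0 < 2 ^ k * r := by positivity
    have hne : y i₀ ≠ x := by
      intro h; rw [h, dist_self] at hdist; linarith
    have hsumle : 2 ^ k * r ≤ ∑ i, dist x (y i) := hdist.trans
      (Finset.single_le_sum (f := fun i => dist x (y i)) (fun _ _ => dist_nonneg)
          (Finset.mem_univ i₀))
    have hKb : |K x y| ≤ A / (2 ^ k * r) ^ (m * n) := by
      refine (hKsize x y ⟨i₀, hne⟩).trans ?_
      gcongr
    have hprodg : ∏ i, g i (y i) =
        (ENNReal.ofReal |b x - c k| + ENNReal.ofReal |b (y j) - c k|) *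
          ∏ i, ENNReal.ofReal |f i (y i)| := by
      simp only [g, Finset.prod_mul_distrib]
      rw [Finset.prod_ite_eq' Finset.univ j
        (fun i => ENNReal.ofReal |b x - c k| + ENNReal.ofReal |b (y i) - c k|)]
      simp
    rw [hprodg, enorm_mul, enorm_mul, mul_assoc]
    have hpe : ‖∏ i, f i (y i)‖ₑ = ∏ i, ENNReal.ofReal |f i (y i)| := by
      rw [Real.enorm_eq_ofReal_abs, Finset.abs_prod,
        ENNReal.ofReal_prod_of_nonneg fun _ _ => abs_nonneg _]
    rw [hpe, Real.enorm_eq_ofReal_abs, Real.enorm_eq_ofReal_abs,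
      ← ENNReal.ofReal_add (abs_nonneg _) (abs_nonneg _)]
    gcongr
    have := abs_sub_le (b x) (c k) (b (y j))
    rwa [abs_sub_comm (c k)] at this
  calc _ ≤ ∫⁻ y in P (k + 1) \ P k,
        ENNReal.ofReal (A / (2 ^ k * r) ^ (m * n)) * ∏ i, g i (y i) :=
        setLIntegral_mono' ((hPm _).diff (hPm _)) hptw
    _ ≤ ∫⁻ y in P (k + 1),
        ENNReal.ofReal (A / (2 ^ k * r) ^ (m * n)) * ∏ i, g i (y i) :=
        lintegral_mono_set Set.sdiff_subset
    _ = ENNReal.ofReal (A / (2 ^ k * r) ^ (m * n)) * ∫⁻ y in P (k + 1), ∏ i, g i (y i) :=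
        lintegral_const_mul' _ _ ENNReal.ofReal_ne_top
    _ = _ := by rw [pi_lintegral z _ g hgm]

lemma k_bound {n m : ℕ} {p : ℝ} {pp : Fin m → ℝ} (hpp : ∀ i, 1 < pp i)
    {φ : EuclideanSpace ℝ (Fin n) → ℝ → ℝ}
    {φi : Fin m → EuclideanSpace ℝ (Fin n) → ℝ → ℝ}
    (hφipos : ∀ i x r, 0 < r → 0 < φi i x r)
    (hprod : ∀ x (r : ℝ), 0 < r → ∏ i, φi i x r ^ (1 / pp i) = φ x r ^ (1 / p))
    {b : EuclideanSpace ℝ (Fin n) → ℝ} (hb : AEMeasurable b volume)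
    (j : Fin m) (f : Fin m → EuclideanSpace ℝ (Fin n) → ℝ) (hf : ∀ i, Measurable (f i))
    (z : EuclideanSpace ℝ (Fin n)) {R : ℝ} (hR : 0 < R) (c : ℝ) (a G : ℝ≥0∞)
    (hjn : (∫⁻ y in ball z R, ENNReal.ofReal |b y - c| ^ (pp j).conjExponent) ≤
        G ^ (pp j).conjExponent * volume (ball z R)) :
    ∏ i, ∫⁻ y in ball z R,
        (if i = j then a + ENNReal.ofReal |b y - c| else 1) * ENNReal.ofReal |f i y| ≤
      (a + G) * (volume (ball z R) ^ m * ENNReal.ofReal (φ z R ^ (1 / p)) *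
        ∏ i, morreyNorm n (pp i) (φi i) (f i)) := by
  have hconst : ∀ (i : Fin m) (a : ℝ≥0∞), ∫⁻ y in ball z R, a * ENNReal.ofReal |f i y| ≤
      a * (volume (ball z R) * ENNReal.ofReal (φi i z R ^ (1 / pp i)) *
        morreyNorm n (pp i) (φi i) (f i)) := by
    intro i a
    refine morrey_holder (Real.HolderConjugate.conjExponent (hpp i)).symm (hφipos i) (hf i) z hR
      (fun _ => a) aemeasurable_const a ?_
    rw [setLIntegral_const]
  have hterm : ∀ i : Fin m, ∫⁻ y in ball z R,
        (if i = j then a + ENNReal.ofReal |b y - c| else 1) * ENNReal.ofReal |f i y| ≤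
      (if i = j then a + G else 1) *
        (volume (ball z R) * ENNReal.ofReal (φi i z R ^ (1 / pp i)) *
        morreyNorm n (pp i) (φi i) (f i)) := by
    intro i
    by_cases hij : i = j
    · subst hij
      simp only [if_true]
      have hfi := hf i
      simp only [add_mul]
      rw [lintegral_add_left (by fun_prop)]
      refine add_le_add (hconst i a) ?_
      exact morrey_holder (Real.HolderConjugate.conjExponent (hpp i)).symm (hφipos i) (hf i) z hR
        (fun y => ENNReal.ofReal |b y - c|) (by fun_prop) G hjn
    · simp only [hij, if_false]
      exact hconst i 1
  refine (Finset.prod_le_prod' fun i _ => hterm i).trans (le_of_eq ?_)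
  rw [Finset.prod_mul_distrib, Finset.prod_mul_distrib, Finset.prod_mul_distrib,
    Finset.prod_ite_eq' Finset.univ j (fun _ => a + G), Finset.prod_const, Finset.card_univ,
    Fintype.card_fin, ← hprod z R hR, ENNReal.ofReal_prod_of_nonneg
      fun i _ => Real.rpow_nonneg (hφipos i z R hR).le _]
  simp

lemma avg_bound {n : ℕ} (F : EuclideanSpace ℝ (Fin n) → ℝ) (z : EuclideanSpace ℝ (Fin n))
    {r : ℝ} (hr : 0 < r) :
    ENNReal.ofReal |⨍ x in ball z r, F x| ≤
      (volume (ball z r))⁻¹ * ∫⁻ x in ball z r, ‖F x‖ₑ := by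
  rw [setAverage_eq, smul_eq_mul, ← Real.enorm_eq_ofReal_abs, enorm_mul]
  gcongr
  · rw [Real.enorm_eq_ofReal_abs, abs_of_nonneg (by positivity), measureReal_def,
      ENNReal.ofReal_inv_of_pos (ENNReal.toReal_pos (vol_ball_pos z hr) (vol_ball_ne_top z)),
      ENNReal.ofReal_toReal (vol_ball_ne_top z)]
  · exact enorm_integral_le_lintegral_enorm _

lemma main_j (n m : ℕ) (p q : ℝ) (pp : Fin m → ℝ)
    (hp : 1 < p) (hpq : p ≤ q) (hq : 1 < q) (hpp : ∀ i, 1 < pp i)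
    (hsum : ∑ i, 1 / pp i = 1 / p)
    (φ ψ : EuclideanSpace ℝ (Fin n) → ℝ → ℝ)
    (φi : Fin m → EuclideanSpace ℝ (Fin n) → ℝ → ℝ)
    (hφpos : ∀ x r, 0 < r → 0 < φ x r)
    (hψpos : ∀ x r, 0 < r → 0 < ψ x r)
    (hφipos : ∀ i x r, 0 < r → 0 < φi i x r)
    (hprod : ∀ x (r : ℝ), 0 < r → ∏ i, φi i x r ^ (1 / pp i) = φ x r ^ (1 / p))
    (hφdec : Gdec n φ) (hφidec : ∀ i, Gdec n (φi i))
    (hφ0 : ∀ x, Filter.Tendsto (fun r => φ x r) (nhdsWithin 0 (Set.Ioi 0)) Filter.atTop)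
    (hφInf : ∀ x, Filter.Tendsto (fun r => φ x r) Filter.atTop (nhds 0))
    (C₁ : ℝ) (hC₁ : 0 < C₁)
    (hint : ∀ x (r : ℝ), 0 < r →
      ∫⁻ t in Set.Ioi r, ENNReal.ofReal (φ x t / t) ≤ ENNReal.ofReal (C₁ * φ x r))
    (hψinc : Ginc n ψ)
    (hψunif : ∃ C > (0 : ℝ), ∀ x y (r : ℝ), 0 < r → dist x y ≤ r → ψ x r ≤ C * ψ y r)
    (C₀ : ℝ) (hC₀ : 0 < C₀)
    (hψφ : ∀ x (r : ℝ), 0 < r → ψ x r * φ x r ^ (1 / p) ≤ C₀ * φ x r ^ (1 / q))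
    (K : EuclideanSpace ℝ (Fin n) → (Fin m → EuclideanSpace ℝ (Fin n)) → ℝ)
    (hKmeas : Measurable (Function.uncurry K))
    (A : ℝ) (hA : 0 < A)
    (hKsize : ∀ x y, (∃ i, y i ≠ x) →
      |K x y| ≤ A / (∑ i, dist x (y i)) ^ (m * n)) (j : Fin m) :
    ∃ C : ℝ, 0 < C ∧
      ∀ (b : EuclideanSpace ℝ (Fin n) → ℝ), LocallyIntegrable b volume →
      ∀ N : ℝ, 0 < N → campanatoNorm n ψ b ≤ ENNReal.ofReal N →
      ∀ (f : Fin m → EuclideanSpace ℝ (Fin n) → ℝ),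
        (∀ i, Measurable (f i)) →
        ∀ z (r : ℝ), 0 < r →
          ENNReal.ofReal
            |⨍ x in ball z r,
              ∫ y in Set.univ.pi (fun _ : Fin m => ((ball z (2 * r))ᶜ : Set (EuclideanSpace ℝ (Fin n)))),
                K x y * (b x - b (y j)) * ∏ i, f i (y i)|
            ≤ ENNReal.ofReal (C * φ z r ^ (1 / q)) *
                ENNReal.ofReal N * ∏ i, morreyNorm n (pp i) (φi i) (f i) := by
  obtain ⟨D, hD, hmono, -⟩ := psi_mono hψpos hψinc
  obtain ⟨Cθ, θ, hCθ, hθ, hθ1, hdecay⟩ := phi_decay n φ hφpos hφdec C₁ hC₁ hint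
  obtain ⟨CJ, hCJ, hjn⟩ := camp_jn hψpos hψinc hψunif (pp j).conjExponent
    (Real.HolderConjugate.conjExponent (hpp j)).symm.lt
  set v := volume (ball (0 : EuclideanSpace ℝ (Fin n)) 1) with hv
  have hv0 : v ≠ 0 := vol_ball_pos _ one_pos
  have hvt : v ≠ ⊤ := vol_ball_ne_top _
  have hvr : 0 < v.toReal := ENNReal.toReal_pos hv0 hvt
  set W : ℝ := A * 4 ^ (m * n) * v.toReal ^ m with hW
  have hW0 : 0 < W := by positivity
  have hq0 : 0 < q := by linarith
  set θ' : ℝ := θ ^ (1 / q) with hθ'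
  have hθ'0 : 0 < θ' := by positivity
  have hθ'1 : θ' < 1 := Real.rpow_lt_one hθ.le hθ1 (by positivity)
  set H : ℝ := (D + 2 ^ n * D + CJ) * W * (C₀ * Cθ ^ (1 / q)) with hH
  have hH0 : 0 < H := by positivity
  have hsumm : Summable fun k : ℕ => ((k : ℝ) + 3) * θ' ^ k := by
    have h1 := summable_pow_mul_geometric_of_norm_lt_one 1 (r := θ')
      (by rwa [Real.norm_eq_abs, abs_of_pos hθ'0])
    have h2 := (summable_geometric_of_lt_one hθ'0.le hθ'1).mul_left 3
    refine (h1.add h2).congr fun k => ?_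
    ring
  set S : ℝ := ∑' k : ℕ, ((k : ℝ) + 3) * θ' ^ k with hS
  have hS0 : 0 < S := hsumm.tsum_pos (fun k => by positivity) 0 (by norm_num)
  refine ⟨H * S, by positivity, fun b hb N hN hbN f hf z r hr => ?_⟩
  set PF := ∏ i, morreyNorm n (pp i) (φi i) (f i) with hPF
  have hbm : AEMeasurable b volume := hb.aestronglyMeasurable.aemeasurable
  have hφz := hφpos z r hr
  set V := volume (ball z r) with hV
  have hV0 : V ≠ 0 := vol_ball_pos z hr
  have hVt : V ≠ ⊤ := vol_ball_ne_top z
  set R : ℕ → ℝ := fun k => 2 ^ (k + 2) * r with hRdef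
  have hR : ∀ k, 0 < R k := fun k => by positivity
  have hψR : ∀ k, 0 < ψ z (R k) := fun k => hψpos z _ (hR k)
  have hφR : ∀ k, 0 < φ z (R k) := fun k => hφpos z _ (hR k)
  set c := ballAvg n b z r with hc
  set e : ℕ → ℝ := fun k => (((k : ℝ) + 2) * (2 ^ n * D) + CJ) * (N * ψ z (R k)) with he
  have he0 : ∀ k, 0 ≤ e k := fun k => by have := hψR k; positivity
  have hQ : ∀ k : ℕ, ENNReal.ofReal (A / (2 ^ k * r) ^ (m * n)) * volume (ball z (R k)) ^ m =
      ENNReal.ofReal W := by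
    intro k
    rw [vol_ball_aux z (hR k), ← hv, ← ENNReal.ofReal_toReal hvt,
      ← ENNReal.ofReal_mul (by have := hR k; positivity),
      ← ENNReal.ofReal_pow (by have := hR k; positivity), ← ENNReal.ofReal_mul (by positivity)]
    congr 1
    rw [hW]
    have : R k = 4 * (2 ^ k * r) := by simp only [hRdef]; ring
    rw [this]
    have ht : 0 < 2 ^ k * r := by positivity
    generalize 2 ^ k * r = t at ht
    rw [mul_pow, ← pow_mul, mul_comm n m, mul_pow]
    field_simp
  have hinner : ∀ x ∈ ball z r,
      ‖∫ y in Set.univ.pi (fun _ : Fin m => ((ball z (2 * r))ᶜ : Set (EuclideanSpace ℝ (Fin n)))),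
        K x y * (b x - b (y j)) * ∏ i, f i (y i)‖ₑ ≤
      ∑' k : ℕ, (ENNReal.ofReal |b x - c| + ENNReal.ofReal (e k)) *
        (ENNReal.ofReal (W * φ z (R k) ^ (1 / p)) * PF) := by
    intro x hx
    refine (enorm_integral_le_lintegral_enorm _).trans ?_
    refine (inner_bound K A hA hKsize hbm j f hf z hr (fun k => ballAvg n b z (R k)) x hx).trans ?_
    refine ENNReal.tsum_le_tsum fun k => ?_
    have h1 := k_bound hpp hφipos hprod hbm j f hf z (hR k) (ballAvg n b z (R k))
      (ENNReal.ofReal |b x - ballAvg n b z (R k)|) (ENNReal.ofReal (CJ * N * ψ z (R k)))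
      (hjn b hb N hN hbN z (R k) (hR k))
    have h2 := camp_chain hψpos hD hmono hb hN hbN z hr (k + 2)
    have hψk := hψR k
    have h3 : ENNReal.ofReal |b x - ballAvg n b z (R k)| + ENNReal.ofReal (CJ * N * ψ z (R k)) ≤
        ENNReal.ofReal |b x - c| + ENNReal.ofReal (e k) := by
      rw [← ENNReal.ofReal_add (abs_nonneg _) (by positivity),
        ← ENNReal.ofReal_add (abs_nonneg _) (he0 k)]
      apply ENNReal.ofReal_le_ofReal
      have := abs_sub_le (b x) c (ballAvg n b z (R k))
      simp only [he]
      push_cast at h2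
      have h4 : ((k : ℝ) + 2) * (2 ^ n * (N * (D * ψ z (R k)))) =
        ((k : ℝ) + 2) * (2 ^ n * D) * (N * ψ z (R k)) := by ring
      have h5 : |c - ballAvg n b z (R k)| ≤ ((k : ℝ) + 2) * (2 ^ n * (N * (D * ψ z (R k)))) := h2
      rw [h4] at h5
      linarith
    calc _ ≤ _ := mul_le_mul_right h1 _
      _ = (ENNReal.ofReal |b x - ballAvg n b z (R k)| + ENNReal.ofReal (CJ * N * ψ z (R k))) *
          ((ENNReal.ofReal (A / (2 ^ k * r) ^ (m * n)) * volume (ball z (R k)) ^ m) *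
            ENNReal.ofReal (φ z (R k) ^ (1 / p)) * PF) := by ring
      _ ≤ _ := by
        rw [hQ k, ← ENNReal.ofReal_mul hW0.le]
        gcongr
  have hterm : ∀ k : ℕ, (ENNReal.ofReal (N * ψ z r) + ENNReal.ofReal (e k)) *
        (ENNReal.ofReal (W * φ z (R k) ^ (1 / p)) * PF) ≤
      ENNReal.ofReal (((k : ℝ) + 3) * θ' ^ k) * (ENNReal.ofReal (H * φ z r ^ (1 / q) * N) * PF) := by
    intro k
    have hψk := hψR k
    have hφk := hφR k
    have hψz := hψpos z r hr
    rw [← mul_assoc, ← mul_assoc]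
    refine mul_le_mul_left ?_ PF
    rw [← ENNReal.ofReal_add (by positivity) (he0 k),
      ← ENNReal.ofReal_mul (add_nonneg (by positivity) (he0 k)),
      ← ENNReal.ofReal_mul (by positivity)]
    apply ENNReal.ofReal_le_ofReal
    have hk2 : (1 : ℝ) ≤ 2 ^ (k + 2) := one_le_pow₀ (by norm_num)
    have h1 : ψ z r ≤ D * ψ z (R k) := hmono z r (R k) hr (by simp only [hRdef]; nlinarith)
    have h2 : ψ z (R k) * φ z (R k) ^ (1 / p) ≤ C₀ * φ z (R k) ^ (1 / q) := hψφ z (R k) (hR k)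
    have h3 : φ z (R k) ^ (1 / q) ≤ Cθ ^ (1 / q) * θ' ^ k * φ z r ^ (1 / q) := by
      have h30 : φ z (R k) ≤ Cθ * θ ^ k * φ z r := by
        refine (hdecay z r (k + 2) hr).trans ?_
        gcongr ?_ * φ z r
        gcongr Cθ * ?_
        exact pow_le_pow_of_le_one hθ.le hθ1.le (by omega)
      calc φ z (R k) ^ (1 / q) ≤ (Cθ * θ ^ k * φ z r) ^ (1 / q) :=
            Real.rpow_le_rpow hφk.le h30 (by positivity)
        _ = _ := by
          rw [Real.mul_rpow (by positivity) hφz.le, Real.mul_rpow hCθ.le (by positivity), hθ',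
            ← Real.rpow_natCast, ← Real.rpow_mul hθ.le, ← Real.rpow_natCast,
            ← Real.rpow_mul hθ.le, mul_comm (k : ℝ)]
    have h4 : N * ψ z r + e k ≤ ((k : ℝ) + 3) * (D + 2 ^ n * D + CJ) * (N * ψ z (R k)) := by
      have h40 : N * ψ z r ≤ D * (N * ψ z (R k)) := by nlinarith
      have h41 : D + (((k : ℝ) + 2) * (2 ^ n * D) + CJ) ≤
          ((k : ℝ) + 3) * (D + 2 ^ n * D + CJ) := by
        have : 0 ≤ (k : ℝ) := Nat.cast_nonneg k
        have h2n : 0 < 2 ^ n * D := by positivity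
        nlinarith [mul_nonneg this hD.le, mul_nonneg this hCJ.le]
      calc N * ψ z r + e k ≤ (D + (((k : ℝ) + 2) * (2 ^ n * D) + CJ)) * (N * ψ z (R k)) := by
            simp only [he]; rw [add_mul]; linarith
        _ ≤ _ := by gcongr
    calc (N * ψ z r + e k) * (W * φ z (R k) ^ (1 / p))
        ≤ (((k : ℝ) + 3) * (D + 2 ^ n * D + CJ) * (N * ψ z (R k))) *
            (W * φ z (R k) ^ (1 / p)) := by gcongr
      _ = ((k : ℝ) + 3) * (D + 2 ^ n * D + CJ) * N * W *
            (ψ z (R k) * φ z (R k) ^ (1 / p)) := by ring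
      _ ≤ ((k : ℝ) + 3) * (D + 2 ^ n * D + CJ) * N * W *
            (C₀ * (Cθ ^ (1 / q) * θ' ^ k * φ z r ^ (1 / q))) := by
          refine mul_le_mul_of_nonneg_left (h2.trans (by gcongr)) (by positivity)
      _ = _ := by rw [hH]; ring
  have hosc0 := camp_osc hψpos hN hbN z hr
  have hβm : AEMeasurable (fun x => ENNReal.ofReal |b x - c|) (volume.restrict (ball z r)) := by
    have := hbm.restrict (s := ball z r)
    fun_prop
  refine (avg_bound _ z hr).trans ?_
  calc _ ≤ V⁻¹ * ∫⁻ x in ball z r, ∑' k : ℕ,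
          (ENNReal.ofReal |b x - c| + ENNReal.ofReal (e k)) *
        (ENNReal.ofReal (W * φ z (R k) ^ (1 / p)) * PF) :=
        mul_le_mul_right (setLIntegral_mono' measurableSet_ball hinner) _
    _ = ∑' k : ℕ, V⁻¹ * (((∫⁻ x in ball z r, ENNReal.ofReal |b x - c|) +
          ENNReal.ofReal (e k) * V) * (ENNReal.ofReal (W * φ z (R k) ^ (1 / p)) * PF)) := by
        rw [lintegral_tsum fun k => (hβm.add_const _).mul_const _, ENNReal.tsum_mul_left]
        congr 2; ext k
        rw [lintegral_mul_const'' _ (hβm.add_const _), lintegral_add_left' hβm,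
          setLIntegral_const]
    _ ≤ ∑' k : ℕ, V⁻¹ * ((ENNReal.ofReal (N * ψ z r) * V +
          ENNReal.ofReal (e k) * V) * (ENNReal.ofReal (W * φ z (R k) ^ (1 / p)) * PF)) := by
        gcongr
    _ = ∑' k : ℕ, (ENNReal.ofReal (N * ψ z r) + ENNReal.ofReal (e k)) *
          (ENNReal.ofReal (W * φ z (R k) ^ (1 / p)) * PF) := by
        congr 1; ext k
        rw [← add_mul]
        calc _ = (V⁻¹ * V) * ((ENNReal.ofReal (N * ψ z r) + ENNReal.ofReal (e k)) *
          (ENNReal.ofReal (W * φ z (R k) ^ (1 / p)) * PF)) := by ring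
          _ = _ := by rw [ENNReal.inv_mul_cancel hV0 hVt, one_mul]
    _ ≤ ∑' k : ℕ, ENNReal.ofReal (((k : ℝ) + 3) * θ' ^ k) *
          (ENNReal.ofReal (H * φ z r ^ (1 / q) * N) * PF) := ENNReal.tsum_le_tsum hterm
    _ = ENNReal.ofReal S * (ENNReal.ofReal (H * φ z r ^ (1 / q) * N) * PF) := by
        rw [ENNReal.tsum_mul_right, ENNReal.ofReal_tsum_of_nonneg (fun k => by positivity) hsumm]
    _ = _ := by
        rw [← mul_assoc, ← ENNReal.ofReal_mul hS0.le, ← ENNReal.ofReal_mul (by positivity)]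
        congr 2; ring


/-- the averaged far commutator term satisfies
`|⨍_B ∫_{((2B)^∁)^m} K(x,y⃗)(b_j(x) − b_j(y_j)) ∏ fᵢ(yᵢ) dy⃗ dx|
   ≤ C φ(z,r)^{1/q} ‖b_j‖_{𝓛^{(1,ψ)}} ∏ ‖fᵢ‖`. -/
theorem averaged_far_commutator_estimate (n m : ℕ) (p q : ℝ) (pp : Fin m → ℝ)
    (hp : 1 < p) (hpq : p ≤ q) (hq : 1 < q) (hpp : ∀ i, 1 < pp i)
    (hsum : ∑ i, 1 / pp i = 1 / p)
    (φ ψ : EuclideanSpace ℝ (Fin n) → ℝ → ℝ)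
    (φi : Fin m → EuclideanSpace ℝ (Fin n) → ℝ → ℝ)
    (hφpos : ∀ x r, 0 < r → 0 < φ x r)
    (hψpos : ∀ x r, 0 < r → 0 < ψ x r)
    (hφipos : ∀ i x r, 0 < r → 0 < φi i x r)
    (hprod : ∀ x (r : ℝ), 0 < r → ∏ i, φi i x r ^ (1 / pp i) = φ x r ^ (1 / p))
    (hφdec : Gdec n φ) (hφidec : ∀ i, Gdec n (φi i))
    (hφ0 : ∀ x, Filter.Tendsto (fun r => φ x r) (nhdsWithin 0 (Set.Ioi 0)) Filter.atTop)
    (hφInf : ∀ x, Filter.Tendsto (fun r => φ x r) Filter.atTop (nhds 0))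
    (C₁ : ℝ) (hC₁ : 0 < C₁)
    (hint : ∀ x (r : ℝ), 0 < r →
      ∫⁻ t in Set.Ioi r, ENNReal.ofReal (φ x t / t) ≤ ENNReal.ofReal (C₁ * φ x r))
    (hψinc : Ginc n ψ)
    (hψunif : ∃ C > (0 : ℝ), ∀ x y (r : ℝ), 0 < r → dist x y ≤ r → ψ x r ≤ C * ψ y r)
    (C₀ : ℝ) (hC₀ : 0 < C₀)
    (hψφ : ∀ x (r : ℝ), 0 < r → ψ x r * φ x r ^ (1 / p) ≤ C₀ * φ x r ^ (1 / q))
    (K : EuclideanSpace ℝ (Fin n) → (Fin m → EuclideanSpace ℝ (Fin n)) → ℝ)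
    (hKmeas : Measurable (Function.uncurry K))
    (A : ℝ) (hA : 0 < A)
    (hKsize : ∀ x y, (∃ i, y i ≠ x) →
      |K x y| ≤ A / (∑ i, dist x (y i)) ^ (m * n)) :
    ∃ C : ℝ, 0 < C ∧
      ∀ (b : EuclideanSpace ℝ (Fin n) → ℝ), LocallyIntegrable b volume →
        campanatoNorm n ψ b ≠ ⊤ →
      ∀ (j : Fin m) (f : Fin m → EuclideanSpace ℝ (Fin n) → ℝ),
        (∀ i, Measurable (f i)) →
        (∀ i, morreyNorm n (pp i) (φi i) (f i) ≠ ⊤) →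
        ∀ z (r : ℝ), 0 < r →
          ENNReal.ofReal
            |⨍ x in ball z r,
              ∫ y in Set.univ.pi (fun _ : Fin m => ((ball z (2 * r))ᶜ : Set (EuclideanSpace ℝ (Fin n)))),
                K x y * (b x - b (y j)) * ∏ i, f i (y i)|
            ≤ ENNReal.ofReal (C * φ z r ^ (1 / q)) *
                campanatoNorm n ψ b * ∏ i, morreyNorm n (pp i) (φi i) (f i) := by
  have hj := fun j => main_j n m p q pp hp hpq hq hpp hsum φ ψ φi hφpos hψpos hφipos hprod hφdec
    hφidec hφ0 hφInf C₁ hC₁ hint hψinc hψunif C₀ hC₀ hψφ K hKmeas A hA hKsize j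
  choose C hC hmain using hj
  refine ⟨1 + ∑ j, C j, by have := Finset.sum_nonneg fun j (_ : j ∈ Finset.univ) => (hC j).le
                           linarith, ?_⟩
  intro b hb hbt j f hf hfm z r hr
  have hCj : C j ≤ 1 + ∑ j, C j := by
    have := Finset.single_le_sum (f := C) (fun i _ => (hC i).le) (Finset.mem_univ j)
    linarith
  have hφz := hφpos z r hr
  set PF := ∏ i, morreyNorm n (pp i) (φi i) (f i) with hPF
  have hPFt : PF ≠ ⊤ := ENNReal.prod_ne_top fun i _ => hfm i
  set X := campanatoNorm n ψ b with hX
  set Y := ENNReal.ofReal (C j * φ z r ^ (1 / q)) with hY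
  have hle : Y ≤ ENNReal.ofReal ((1 + ∑ j, C j) * φ z r ^ (1 / q)) := by
    apply ENNReal.ofReal_le_ofReal; gcongr
  refine le_trans ?_ (mul_le_mul_left (mul_le_mul_left hle X) PF)
  have hT : Filter.Tendsto (fun ε : ℝ => Y * ENNReal.ofReal (X.toReal + ε) * PF)
      (nhdsWithin 0 (Set.Ioi 0)) (nhds (Y * ENNReal.ofReal (X.toReal + 0) * PF)) := by
    have h1 : Filter.Tendsto (fun ε : ℝ => X.toReal + ε) (nhdsWithin 0 (Set.Ioi 0))
        (nhds (X.toReal + 0)) :=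
      ((continuous_const.add continuous_id).tendsto 0).mono_left nhdsWithin_le_nhds
    have h2 := ENNReal.tendsto_ofReal h1
    have h3 := ENNReal.Tendsto.const_mul (a := Y) h2 (Or.inr ENNReal.ofReal_ne_top)
    exact ENNReal.Tendsto.mul_const h3 (Or.inr hPFt)
  rw [add_zero, ENNReal.ofReal_toReal hbt] at hT
  refine ge_of_tendsto hT ?_
  filter_upwards [self_mem_nhdsWithin] with ε hε
  have hε0 : 0 < ε := hε
  have hX0 : 0 ≤ X.toReal := ENNReal.toReal_nonneg
  refine hmain j b hb (X.toReal + ε) (by linarith) ?_ f hf z r hr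
  rw [← hX]
  calc X = ENNReal.ofReal X.toReal := (ENNReal.ofReal_toReal hbt).symm
    _ ≤ _ := ENNReal.ofReal_le_ofReal (by linarith)
end

section
/- Let m ∈ ℕ, ψ : ℝⁿ×(0,∞) → (0,∞), and let b_1,…,b_m be locally integrable functions on ℝⁿ. The following are equivalent: (a) sup_B (1/(ψ(B)|B|^{m+1})) ∫_B ∫_{B^m} |∑_{j=1}^m (b_j(x) − b_j(y_j))| dy⃗ dx < ∞; (b) sup_B (1/(ψ(B)|B|^m)) ∫_{B^m} |∑_{j=1}^m (b_j(x_j) − b_B^j)| dx⃗ < ∞, where b_B^j = (1/|B|)∫_B b_j; (c) sup_B (1/(ψ(B)|B|^{2m})) ∫_{B^m}∫_{B^m} |∑_{j=1}^m (b_j(x_j) − b_j(y_j))| dy⃗ dx⃗ < ∞; (d) b_1,…,b_m ∈ 𝓛^{(1,ψ)}(ℝⁿ), i.e. sup_B (1/ψ(B)) (1/|B|)∫_B |b_j − b_B^j| < ∞ for each j. In all suprema, B ranges over all balls in ℝⁿ, ψ(B) = ψ(x,r) for B = B(x,r), and B^m is the m-fold product of B. Moreover, in the implication (d) ⇒ (a)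 the supremum in (a) is bounded by a constant multiple of max_j ‖b_j‖_{𝓛^{(1,ψ)}}, and in (c) ⇒ (d) each ‖b_j‖_{𝓛^{(1,ψ)}} is bounded by a constant multiple of the supremum in (c). -/
open MeasureTheory Metric ENNReal

/-- `[b⃗]_*`: the quantity in (a). -/
noncomputable def quantA (n m : ℕ) (ψ : EuclideanSpace ℝ (Fin n) → ℝ → ℝ)
    (b : Fin m → EuclideanSpace ℝ (Fin n) → ℝ) : ℝ≥0∞ :=
  ⨆ (z : EuclideanSpace ℝ (Fin n)) (r : ℝ) (_ : 0 < r),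
    (∫⁻ x in ball z r,
        ∫⁻ y in Set.univ.pi (fun _ : Fin m => (ball z r : Set (EuclideanSpace ℝ (Fin n)))),
          ENNReal.ofReal |∑ j, (b j x - b j (y j))|) /
      (ENNReal.ofReal (ψ z r) * volume (ball z r) ^ (m + 1))

/-- `[b⃗]_{**}`: the quantity in (b). -/
noncomputable def quantB (n m : ℕ) (ψ : EuclideanSpace ℝ (Fin n) → ℝ → ℝ)
    (b : Fin m → EuclideanSpace ℝ (Fin n) → ℝ) : ℝ≥0∞ :=
  ⨆ (z : EuclideanSpace ℝ (Fin n)) (r : ℝ) (_ : 0 < r),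
    (∫⁻ x in Set.univ.pi (fun _ : Fin m => (ball z r : Set (EuclideanSpace ℝ (Fin n)))),
        ENNReal.ofReal |∑ j, (b j (x j) - ballAvg n (b j) z r)|) /
      (ENNReal.ofReal (ψ z r) * volume (ball z r) ^ m)

/-- `[b⃗]_{***}`: the quantity in (c). -/
noncomputable def quantC (n m : ℕ) (ψ : EuclideanSpace ℝ (Fin n) → ℝ → ℝ)
    (b : Fin m → EuclideanSpace ℝ (Fin n) → ℝ) : ℝ≥0∞ :=
  ⨆ (z : EuclideanSpace ℝ (Fin n)) (r : ℝ) (_ : 0 < r),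
    (∫⁻ x in Set.univ.pi (fun _ : Fin m => (ball z r : Set (EuclideanSpace ℝ (Fin n)))),
        ∫⁻ y in Set.univ.pi (fun _ : Fin m => (ball z r : Set (EuclideanSpace ℝ (Fin n)))),
          ENNReal.ofReal |∑ j, (b j (x j) - b j (y j))|) /
      (ENNReal.ofReal (ψ z r) * volume (ball z r) ^ (2 * m))

section CampanatoHelpers

variable {E : Type*} [MeasurableSpace E]

lemma jensen_zero {α : Type*} [MeasurableSpace α] (ν : Measure α) [IsFiniteMeasure ν]
    (g : α → ℝ) (hg : Integrable g ν) (h0 : ∫ y, g y ∂ν = 0) (c : ℝ) :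
    ν Set.univ * ‖c‖ₑ ≤ ∫⁻ y, ‖c + g y‖ₑ ∂ν := by
  have h := enorm_integral_le_lintegral_enorm (μ := ν) (fun y => c + g y)
  rw [integral_add (integrable_const c) hg, h0, add_zero, integral_const, smul_eq_mul,
    enorm_mul] at h
  convert h using 2
  rw [Real.enorm_eq_ofReal measureReal_nonneg, Measure.real, ENNReal.ofReal_toReal
    (measure_ne_top _ _)]

lemma pi_eval_integrable {m : ℕ} (μ : Measure E) [IsFiniteMeasure μ] (f : E → ℝ)
    (hf : Integrable f μ) (i : Fin m) :
    Integrable (fun y : Fin m → E => f (y i)) (Measure.pi fun _ => μ) := by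
  have h : Integrable f (Measure.map (Function.eval i) (Measure.pi fun _ : Fin m => μ)) := by
    rw [Measure.pi_map_eval]
    exact hf.smul_measure (ENNReal.prod_ne_top fun _ _ => measure_ne_top _ _)
  exact h.comp_measurable (measurable_pi_apply i)

lemma pi_eval_integral {m : ℕ} (μ : Measure E) [IsFiniteMeasure μ] (f : E → ℝ)
    (hf : Integrable f μ) (h0 : ∫ y, f y ∂μ = 0) (i : Fin m) :
    ∫ y : Fin m → E, f (y i) ∂(Measure.pi fun _ => μ) = 0 := by
  have h : Integrable f (Measure.map (Function.eval i) (Measure.pi fun _ : Fin m => μ)) := by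
    rw [Measure.pi_map_eval]
    exact hf.smul_measure (ENNReal.prod_ne_top fun _ _ => measure_ne_top _ _)
  have := integral_map (μ := Measure.pi fun _ : Fin m => μ) (φ := fun y : Fin m → E => y i) (f := f)
    (measurable_pi_apply i).aemeasurable h.aestronglyMeasurable
  change ∫ y, f y ∂(Measure.map (Function.eval i) (Measure.pi fun _ : Fin m => μ)) = _ at this
  rw [Measure.pi_map_eval, integral_smul_measure, h0, smul_zero] at this
  exact this.symm

lemma pi_eval_lintegral {m : ℕ} (μ : Measure E) [IsFiniteMeasure μ] (f : E → ℝ)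
    (hf : Integrable f μ) (i : Fin m) :
    μ Set.univ * ∫⁻ y : Fin m → E, ‖f (y i)‖ₑ ∂(Measure.pi fun _ => μ)
      = μ Set.univ ^ m * ∫⁻ y, ‖f y‖ₑ ∂μ := by
  have h : AEMeasurable (fun y => ‖f y‖ₑ)
      (Measure.map (Function.eval i) (Measure.pi fun _ : Fin m => μ)) := by
    rw [Measure.pi_map_eval]
    exact (hf.smul_measure (ENNReal.prod_ne_top fun _ _ => measure_ne_top _ _)).aestronglyMeasurable.enorm
  have := lintegral_map' h (measurable_pi_apply i).aemeasurable
  rw [Measure.pi_map_eval, lintegral_smul_measure] at this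
  change _ = ∫⁻ y : Fin m → E, ‖f (y i)‖ₑ ∂(Measure.pi fun _ => μ) at this
  rw [← this, smul_eq_mul, ← mul_assoc, Finset.mul_prod_erase Finset.univ
    (fun _ => μ Set.univ) (Finset.mem_univ i)]
  simp

variable {m : ℕ} (μ : Measure E) [IsFiniteMeasure μ] (X : Fin m → E → ℝ)

lemma sumF_integrable (hX : ∀ j, Integrable (X j) μ) :
    Integrable (fun y : Fin m → E => ∑ j, X j (y j)) (Measure.pi fun _ => μ) :=
  integrable_finsetSum _ fun j _ => pi_eval_integrable μ (X j) (hX j) j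

lemma sumF_integral (hX : ∀ j, Integrable (X j) μ) (h0 : ∀ j, ∫ y, X j y ∂μ = 0) :
    ∫ y : Fin m → E, ∑ j, X j (y j) ∂(Measure.pi fun _ => μ) = 0 := by
  rw [integral_finsetSum _ fun j _ => pi_eval_integrable μ (X j) (hX j) j]
  exact Finset.sum_eq_zero fun j _ => pi_eval_integral μ (X j) (hX j) (h0 j) j

lemma key_BA (hX : ∀ j, Integrable (X j) μ) (h0 : ∀ j, ∫ y, X j y ∂μ = 0) :
    μ Set.univ * ∫⁻ y : Fin m → E, ‖∑ j, X j (y j)‖ₑ ∂(Measure.pi fun _ => μ) ≤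
      ∫⁻ x, ∫⁻ y : Fin m → E, ‖∑ j, (X j x - X j (y j))‖ₑ ∂(Measure.pi fun _ => μ) ∂μ := by
  have hS : Integrable (fun x => ∑ j, X j x) μ := integrable_finsetSum _ fun j _ => hX j
  have hS0 : ∫ x, ∑ j, X j x ∂μ = 0 := by
    rw [integral_finsetSum _ fun j _ => hX j]
    exact Finset.sum_eq_zero fun j _ => h0 j
  rw [lintegral_lintegral_swap, ← lintegral_const_mul' _ _ (measure_ne_top _ _)]
  · refine lintegral_mono fun y => ?_
    have := jensen_zero μ _ hS hS0 (-∑ j, X j (y j))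
    rw [enorm_neg] at this
    refine this.trans (le_of_eq (lintegral_congr fun x => ?_))
    rw [Finset.sum_sub_distrib]; congr 1; ring
  · simp only [Finset.sum_sub_distrib]
    exact (hS.aestronglyMeasurable.comp_fst.sub
      (sumF_integrable μ X hX).aestronglyMeasurable.comp_snd).enorm

lemma key_BC (hX : ∀ j, Integrable (X j) μ) (h0 : ∀ j, ∫ y, X j y ∂μ = 0) :
    μ Set.univ ^ m * ∫⁻ y : Fin m → E, ‖∑ j, X j (y j)‖ₑ ∂(Measure.pi fun _ => μ) ≤
      ∫⁻ x : Fin m → E, ∫⁻ y : Fin m → E, ‖∑ j, (X j (x j) - X j (y j))‖ₑ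
        ∂(Measure.pi fun _ => μ) ∂(Measure.pi fun _ => μ) := by
  rw [← lintegral_const_mul' _ _ (by finiteness)]
  refine lintegral_mono fun x => ?_
  have := jensen_zero (Measure.pi fun _ : Fin m => μ) _ (sumF_integrable μ X hX).neg
    (by simp only [Pi.neg_apply]; rw [integral_neg, sumF_integral μ X hX h0, neg_zero])
    (∑ j, X j (x j))
  simp only [Measure.pi_univ, Finset.prod_const, Finset.card_univ, Fintype.card_fin] at this
  refine this.trans (le_of_eq (lintegral_congr fun x => ?_))
  rw [Finset.sum_sub_distrib, Pi.neg_apply, sub_eq_add_neg]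

lemma key_CB (hX : ∀ j, Integrable (X j) μ) :
      ∫⁻ x : Fin m → E, ∫⁻ y : Fin m → E, ‖∑ j, (X j (x j) - X j (y j))‖ₑ
        ∂(Measure.pi fun _ => μ) ∂(Measure.pi fun _ => μ) ≤ 
    2 * (μ Set.univ ^ m * ∫⁻ y : Fin m → E, ‖∑ j, X j (y j)‖ₑ ∂(Measure.pi fun _ => μ)) := by
  have hm := (sumF_integrable μ X hX).aestronglyMeasurable.enorm
  calc _ ≤ ∫⁻ x : Fin m → E, ∫⁻ y : Fin m → E, (‖∑ j, X j (x j)‖ₑ + ‖∑ j, X j (y j)‖ₑ)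
        ∂(Measure.pi fun _ => μ) ∂(Measure.pi fun _ => μ) := by
        refine lintegral_mono fun x => lintegral_mono fun y => ?_
        rw [Finset.sum_sub_distrib]
        exact enorm_sub_le
    _ = _ := by
        simp_rw [lintegral_add_left measurable_const]
        rw [lintegral_add_right _ measurable_const]
        simp only [lintegral_const, Measure.pi_univ, Finset.prod_const, Finset.card_univ,
          Fintype.card_fin]
        rw [lintegral_mul_const'' _ hm]
        ring

lemma key_AD (hX : ∀ j, Integrable (X j) μ) :
      ∫⁻ x, ∫⁻ y : Fin m → E, ‖∑ j, (X j x - X j (y j))‖ₑ ∂(Measure.pi fun _ => μ) ∂μ ≤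
      2 * (μ Set.univ ^ m * ∑ j, ∫⁻ y, ‖X j y‖ₑ ∂μ) := by
  calc _ ≤ ∫⁻ x, ∫⁻ y : Fin m → E, (∑ j, ‖X j x‖ₑ + ∑ j, ‖X j (y j)‖ₑ)
        ∂(Measure.pi fun _ => μ) ∂μ := by
        refine lintegral_mono fun x => lintegral_mono fun y => ?_
        rw [Finset.sum_sub_distrib]
        exact enorm_sub_le.trans (add_le_add (enorm_sum_le _ _) (enorm_sum_le _ _))
    _ = _ := by
        simp_rw [lintegral_add_left measurable_const]
        rw [lintegral_add_right _ measurable_const]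
        simp only [lintegral_const, Measure.pi_univ, Finset.prod_const, Finset.card_univ,
          Fintype.card_fin]
        rw [lintegral_mul_const' _ _ (by finiteness),
          lintegral_finsetSum' _ (fun j _ => (hX j).aestronglyMeasurable.enorm),
          lintegral_finsetSum' _ (fun j _ =>
            (pi_eval_integrable μ (X j) (hX j) j).aestronglyMeasurable.enorm),
          mul_comm _ (μ Set.univ), Finset.mul_sum]
        simp_rw [pi_eval_lintegral μ (X _) (hX _)]
        rw [← Finset.mul_sum]
        ring

lemma key_DB {k : ℕ} (X : Fin (k + 1) → E → ℝ)
    (hX : ∀ j, Integrable (X j) μ) (h0 : ∀ j, ∫ y, X j y ∂μ = 0) (j : Fin (k + 1)) :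
    μ Set.univ ^ k * ∫⁻ y, ‖X j y‖ₑ ∂μ ≤
      ∫⁻ y : Fin (k + 1) → E, ‖∑ j, X j (y j)‖ₑ ∂(Measure.pi fun _ => μ) := by
  have hmp := measurePreserving_piFinSuccAbove (fun _ : Fin (k + 1) => μ) j
  have h1 := hmp.lintegral_comp_emb (MeasurableEquiv.measurableEmbedding _)
    (fun p => ‖X j p.1 + ∑ i, X (j.succAbove i) (p.2 i)‖ₑ)
  have h2 : ∀ y : Fin (k + 1) → E, ∑ i, X i (y i) =
      X j (MeasurableEquiv.piFinSuccAbove (fun _ => E) j y).1 + ∑ i, X (j.succAbove i)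
        ((MeasurableEquiv.piFinSuccAbove (fun _ => E) j y).2 i) := by
    intro y
    rw [Fin.sum_univ_succAbove _ j]
    rfl
  simp_rw [h2]
  rw [h1, lintegral_prod, ← lintegral_const_mul' _ _ (by finiteness)]
  · refine lintegral_mono fun x => ?_
    have := jensen_zero (Measure.pi fun _ : Fin k => μ) _
      (sumF_integrable μ (fun i => X (j.succAbove i)) fun i => hX _)
      (sumF_integral μ (fun i => X (j.succAbove i)) (fun i => hX _) fun i => h0 _) (X j x)
    simpa only [Measure.pi_univ, Finset.prod_const, Finset.card_univ, Fintype.card_fin] using this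
  · exact ((hX j).aestronglyMeasurable.comp_fst.add
      (sumF_integrable μ (fun i => X (j.succAbove i))
        fun i => hX _).aestronglyMeasurable.comp_snd).enorm

end CampanatoHelpers

section CampanatoMain

variable {n m : ℕ} {ψ : EuclideanSpace ℝ (Fin n) → ℝ → ℝ}
  {b : Fin m → EuclideanSpace ℝ (Fin n) → ℝ}

lemma restrict_volume_pi (B : Set (EuclideanSpace ℝ (Fin n))) :
    (volume : Measure (Fin m → EuclideanSpace ℝ (Fin n))).restrict
      (Set.univ.pi (fun _ : Fin m => B)) = Measure.pi fun _ => volume.restrict B := by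
  rw [volume_pi, Measure.restrict_pi_pi]

/-- The centred function on a ball. -/
noncomputable def ctr (b : Fin m → EuclideanSpace ℝ (Fin n) → ℝ) (z : EuclideanSpace ℝ (Fin n))
    (r : ℝ) (j : Fin m) (x : EuclideanSpace ℝ (Fin n)) : ℝ := b j x - ballAvg n (b j) z r

lemma ctr_sub (z : EuclideanSpace ℝ (Fin n)) (r : ℝ) (j : Fin m)
    (x y : EuclideanSpace ℝ (Fin n)) : b j x - b j y = ctr b z r j x - ctr b z r j y := by
  simp [ctr]

lemma ball_finite (z : EuclideanSpace ℝ (Fin n)) (r : ℝ) :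
    IsFiniteMeasure (volume.restrict (ball z r)) :=
  ⟨by rw [Measure.restrict_apply_univ]; exact measure_ball_lt_top⟩

lemma ctr_integrable (hb : ∀ j, LocallyIntegrable (b j) volume)
    (z : EuclideanSpace ℝ (Fin n)) (r : ℝ) (j : Fin m) :
    Integrable (ctr b z r j) (volume.restrict (ball z r)) := by
  have := ball_finite z r
  refine Integrable.sub ?_ (integrable_const _)
  exact ((hb j).integrableOn_isCompact (isCompact_closedBall z r)).mono_set ball_subset_closedBall

lemma ctr_integral (z : EuclideanSpace ℝ (Fin n)) (r : ℝ) (j : Fin m) :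
    ∫ x, ctr b z r j x ∂(volume.restrict (ball z r)) = 0 := by
  have := ball_finite z r
  exact integral_sub_average _ _

lemma quantB_le_quantA (hb : ∀ j, LocallyIntegrable (b j) volume) :
    quantB n m ψ b ≤ quantA n m ψ b := by
  refine iSup_mono fun z => iSup_mono fun r => iSup_mono fun hr => ?_
  have := ball_finite z r
  have hV0 : volume (ball z r) ≠ 0 := (measure_ball_pos volume z hr).ne'
  have hVt : volume (ball z r) ≠ ⊤ := measure_ball_lt_top.ne
  have := key_BA (volume.restrict (ball z r)) (ctr b z r) (ctr_integrable hb z r)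
    (ctr_integral z r)
  simp only [restrict_volume_pi, ← Real.enorm_eq_ofReal_abs]
  rw [← ENNReal.mul_div_mul_left _ _ hV0 hVt, pow_succ', mul_left_comm]
  rw [Measure.restrict_apply_univ] at this
  simp only [← ctr_sub] at this
  exact ENNReal.div_le_div_right this _

lemma quantB_le_quantC (hb : ∀ j, LocallyIntegrable (b j) volume) :
    quantB n m ψ b ≤ quantC n m ψ b := by
  refine iSup_mono fun z => iSup_mono fun r => iSup_mono fun hr => ?_
  have := ball_finite z r
  have hV0 : volume (ball z r) ≠ 0 := (measure_ball_pos volume z hr).ne'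
  have hVt : volume (ball z r) ≠ ⊤ := measure_ball_lt_top.ne
  have := key_BC (volume.restrict (ball z r)) (ctr b z r) (ctr_integrable hb z r)
    (ctr_integral z r)
  simp only [restrict_volume_pi, ← Real.enorm_eq_ofReal_abs]
  rw [← ENNReal.mul_div_mul_left _ _ (pow_ne_zero m hV0) (ENNReal.pow_ne_top hVt),
    two_mul m, pow_add, mul_left_comm]
  rw [Measure.restrict_apply_univ] at this
  simp only [← ctr_sub] at this
  exact ENNReal.div_le_div_right this _

lemma quantC_le_quantB (hb : ∀ j, LocallyIntegrable (b j) volume) :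
    quantC n m ψ b ≤ 2 * quantB n m ψ b := by
  refine iSup_le fun z => iSup_le fun r => iSup_le fun hr => ?_
  refine le_trans ?_ (mul_le_mul_right (le_iSup_of_le z (le_iSup_of_le r
    (le_iSup_of_le hr le_rfl))) _)
  have := ball_finite z r
  have hV0 : volume (ball z r) ≠ 0 := (measure_ball_pos volume z hr).ne'
  have hVt : volume (ball z r) ≠ ⊤ := measure_ball_lt_top.ne
  have := key_CB (volume.restrict (ball z r)) (ctr b z r) (ctr_integrable hb z r)
  simp only [restrict_volume_pi, ← Real.enorm_eq_ofReal_abs]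
  rw [← ENNReal.mul_div_mul_left _ (_ * volume (ball z r) ^ m)
    (pow_ne_zero m hV0) (ENNReal.pow_ne_top hVt),
    two_mul m, pow_add, mul_left_comm, ← mul_div_assoc]
  rw [Measure.restrict_apply_univ] at this
  simp only [← ctr_sub] at this
  exact ENNReal.div_le_div_right this _

lemma quantA_le (hb : ∀ j, LocallyIntegrable (b j) volume) :
    quantA n m ψ b ≤ (2 * m) * ⨆ j, campanatoNorm n ψ (b j) := by
  refine iSup_le fun z => iSup_le fun r => iSup_le fun hr => ?_
  have := ball_finite z r
  have hV0 : volume (ball z r) ≠ 0 := (measure_ball_pos volume z hr).ne'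
  have hVt : volume (ball z r) ≠ ⊤ := measure_ball_lt_top.ne
  have h := key_AD (volume.restrict (ball z r)) (ctr b z r) (ctr_integrable hb z r)
  simp only [restrict_volume_pi, ← Real.enorm_eq_ofReal_abs]
  rw [Measure.restrict_apply_univ] at h
  simp only [← ctr_sub] at h
  refine (ENNReal.div_le_div_right h _).trans ?_
  rw [pow_succ, mul_left_comm (ENNReal.ofReal _), mul_div_assoc,
    ENNReal.mul_div_mul_left _ _ (pow_ne_zero m hV0) (ENNReal.pow_ne_top hVt), mul_assoc]
  refine mul_le_mul_right ?_ _
  rw [div_eq_mul_inv, Finset.sum_mul]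
  calc _ ≤ ∑ j : Fin m, ⨆ j, campanatoNorm n ψ (b j) := by
        refine Finset.sum_le_sum fun j _ => le_iSup_of_le j ?_
        rw [← div_eq_mul_inv]
        simp only [campanatoNorm, ← Real.enorm_eq_ofReal_abs]
        exact le_iSup_of_le z (le_iSup_of_le r (le_iSup_of_le hr le_rfl))
    _ = _ := by simp

lemma norm_le_quantB (hb : ∀ j, LocallyIntegrable (b j) volume) (j : Fin m) :
    campanatoNorm n ψ (b j) ≤ quantB n m ψ b := by
  obtain _ | k := m
  · exact j.elim0
  refine iSup_mono fun z => iSup_mono fun r => iSup_mono fun hr => ?_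
  have := ball_finite z r
  have hV0 : volume (ball z r) ≠ 0 := (measure_ball_pos volume z hr).ne'
  have hVt : volume (ball z r) ≠ ⊤ := measure_ball_lt_top.ne
  have := key_DB (volume.restrict (ball z r)) (ctr b z r) (ctr_integrable hb z r)
    (ctr_integral z r) j
  simp only [restrict_volume_pi, ← Real.enorm_eq_ofReal_abs]
  rw [← ENNReal.mul_div_mul_left _ _ (pow_ne_zero k hV0) (ENNReal.pow_ne_top hVt),
    pow_succ, mul_left_comm]
  rw [Measure.restrict_apply_univ] at this
  exact ENNReal.div_le_div_right this _

end CampanatoMain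

/-- equivalence of the finiteness of `[b⃗]_*`, `[b⃗]_{**}`, `[b⃗]_{***}`
and membership of each `b_j` in `𝓛^{(1,ψ)}`, together with the quantitative bounds
`[b⃗]_* ≲ max_j ‖b_j‖` and `‖b_j‖ ≲ [b⃗]_{***}`. -/
theorem campanato_vector_characterization (n m : ℕ)
    (ψ : EuclideanSpace ℝ (Fin n) → ℝ → ℝ)
    (hψpos : ∀ x r, 0 < r → 0 < ψ x r)
    (b : Fin m → EuclideanSpace ℝ (Fin n) → ℝ)
    (hb : ∀ j, LocallyIntegrable (b j) volume) :
    ((quantA n m ψ b ≠ ⊤ ↔ quantB n m ψ b ≠ ⊤) ∧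
      (quantB n m ψ b ≠ ⊤ ↔ quantC n m ψ b ≠ ⊤) ∧
      (quantC n m ψ b ≠ ⊤ ↔ ∀ j, campanatoNorm n ψ (b j) ≠ ⊤)) ∧
    (∃ C : ℝ≥0∞, C ≠ ⊤ ∧
      ∀ b' : Fin m → EuclideanSpace ℝ (Fin n) → ℝ,
        (∀ j, LocallyIntegrable (b' j) volume) →
        quantA n m ψ b' ≤ C * ⨆ j, campanatoNorm n ψ (b' j)) ∧
    (∃ C : ℝ≥0∞, C ≠ ⊤ ∧
      ∀ b' : Fin m → EuclideanSpace ℝ (Fin n) → ℝ,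
        (∀ j, LocallyIntegrable (b' j) volume) →
        ∀ j, campanatoNorm n ψ (b' j) ≤ C * quantC n m ψ b') := by
  have hBA := quantB_le_quantA (ψ := ψ) hb
  have hBC := quantB_le_quantC (ψ := ψ) hb
  have hCB := quantC_le_quantB (ψ := ψ) hb
  have hDB := norm_le_quantB (ψ := ψ) hb
  have hAD := quantA_le (ψ := ψ) hb
  have h2m : (2 * m : ℝ≥0∞) ≠ ⊤ := ENNReal.mul_ne_top (by simp) (by simp)
  have hDA : (∀ j, campanatoNorm n ψ (b j) ≠ ⊤) → quantA n m ψ b ≠ ⊤ := by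
    intro h
    refine ne_top_of_le_ne_top (ENNReal.mul_ne_top h2m ?_) hAD
    have : (⨆ j, campanatoNorm n ψ (b j)) ≤ ∑ j, campanatoNorm n ψ (b j) :=
      iSup_le fun j => Finset.single_le_sum (f := fun j => campanatoNorm n ψ (b j))
        (fun _ _ => zero_le) (Finset.mem_univ j)
    exact ne_top_of_le_ne_top (ENNReal.sum_ne_top.2 fun j _ => h j) this
  have hB_D : quantB n m ψ b ≠ ⊤ → ∀ j, campanatoNorm n ψ (b j) ≠ ⊤ :=
    fun h j => ne_top_of_le_ne_top h (hDB j)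
  have hA_B : quantA n m ψ b ≠ ⊤ → quantB n m ψ b ≠ ⊤ := fun h => ne_top_of_le_ne_top h hBA
  have hC_B : quantC n m ψ b ≠ ⊤ → quantB n m ψ b ≠ ⊤ := fun h => ne_top_of_le_ne_top h hBC
  have hB_C : quantB n m ψ b ≠ ⊤ → quantC n m ψ b ≠ ⊤ :=
    fun h => ne_top_of_le_ne_top (ENNReal.mul_ne_top (by simp) h) hCB
  refine ⟨⟨⟨hA_B, fun h => hDA (hB_D h)⟩, ⟨hB_C, hC_B⟩,
    ⟨fun h => hB_D (hC_B h), fun h => hB_C (hA_B (hDA h))⟩⟩, ?_, ?_⟩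
  · exact ⟨2 * m, h2m, fun b' hb' => quantA_le hb'⟩
  · exact ⟨1, by simp, fun b' hb' j => by
      rw [one_mul]
      exact (norm_le_quantB hb' j).trans (quantB_le_quantC hb')⟩
end
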